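/- arXiv:2406.16816 — 2 statements merged into one kernel-verified Lean document; each statement's English description precedes it below -/
import Mathlib

section
/- Assume k ≥ 2. Let m_opt ∈ {1, …, N} satisfy B(m_opt) ≤ B(m) for all m ∈ {1, …, N}, and assume B(m_opt) < N. Let λ̄ := trace(L)/N, μ_ub := (√(N/B(m_opt)) − 1)/λ̄, and for μ' > 0 define τ_GLR(μ') := (k/N) · (∑_{i=1}^{N} (1 + μ'λᵢ)⁻² − B(m_opt)) / (k + B_k(m_opt) − ∑_{i=1}^{k} (1 − (1 + μ'λᵢ)⁻¹)²). Then μ_ub > 0, m_opt ≤ ⌈(N+1)/2⌉, and for every μ' with 0 < μ' < μ_ub: τ_GLR(μ') > 0, and for every SNR with 0 < SNR < τ_GLR(μ') and every finite S ⊆ Fin N with |S| = m_opt, the GLR quantities computed with parameter μ' satisfy ξ₁(S) + (k/(N·SNR))·ξ₂(S) < ξ₁(Fin N) + (k/(N·SNR))·ξ₂(Fin N); that is, any sample set of size m_opt is better than full observation. -/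
open Matrix

/-- Squared Frobenius norm `‖A‖_F² = trace(Aᵀ A)`. -/
noncomputable def frobSq {m n : Type*} [Fintype m] [Fintype n] (A : Matrix m n ℝ) : ℝ :=
  Matrix.trace (Aᵀ * A)

/-- `ω(x) = (√x + 1/√x)²/4`, from the Kantorovich inequality. -/
noncomputable def omegaFn (x : ℝ) : ℝ := (Real.sqrt x + 1 / Real.sqrt x) ^ 2 / 4

/-- The `j`-th eigenvalue `λⱼ` of the Laplacian, 1-indexed (with `λⱼ = 0` for `j ≤ 0` since
`λ₁ = 0`, and `0` beyond `N`). -/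
noncomputable def eig1 {N : ℕ} (lam : Fin N → ℝ) (j : ℕ) : ℝ :=
  if h : j - 1 < N then lam ⟨j - 1, h⟩ else 0

/-- `B(m) = r·(N/m) + ∑_{i=2}^{m} ω(max(1, λ_{N+2−i}/λᵢ))` where `r = ω(λ_N/λ₂)`. -/
noncomputable def Bfull {N : ℕ} (lam : Fin N → ℝ) (m : ℕ) : ℝ :=
  omegaFn (eig1 lam N / eig1 lam 2) * ((N : ℝ) / (m : ℝ)) +
    ∑ i ∈ Finset.Icc 2 m, omegaFn (max 1 (eig1 lam (N + 2 - i) / eig1 lam i))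

/-- `B_k(m) = r_bl·(N/m) + ∑_{i=2}^{m} ω(max(1, λ_{k+2−i}/λᵢ))` where `r_bl = ω(λ_k/λ₂)`. -/
noncomputable def Bbl {N : ℕ} (lam : Fin N → ℝ) (k m : ℕ) : ℝ :=
  omegaFn (eig1 lam k / eig1 lam 2) * ((N : ℝ) / (m : ℝ)) +
    ∑ i ∈ Finset.Icc 2 m, omegaFn (max 1 (eig1 lam (k + 2 - i) / eig1 lam i))


lemma omegaFn_eq {x : ℝ} (hx : 0 < x) : omegaFn x = 1 + (x + 1 / x - 2) / 4 := by
  unfold omegaFn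
  have h1 : Real.sqrt x ≠ 0 := (Real.sqrt_pos.mpr hx).ne'
  have h2 : Real.sqrt x ^ 2 = x := Real.sq_sqrt hx.le
  rw [← h2]
  rw [Real.sqrt_sq (Real.sqrt_nonneg x)]
  field_simp
  ring

lemma omegaFn_one : omegaFn 1 = 1 := by
  rw [omegaFn_eq one_pos]; norm_num

lemma one_le_omegaFn {x : ℝ} (hx : 0 < x) : 1 ≤ omegaFn x := by
  rw [omegaFn_eq hx]
  have : x + 1 / x - 2 = (x - 1) ^ 2 / x := by field_simp; ring
  rw [this]
  have : 0 ≤ (x - 1) ^ 2 / x / 4 := by positivity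
  linarith

/-- Kantorovich-type inequality with a truncated left-hand side. -/
lemma kant_aux {ι : Type*} [DecidableEq ι] (s t : Finset ι) (hts : t ⊆ s) (K a b : ι → ℝ) (lo hi : ℝ)
    (hlo : 0 < lo) (hhi : 0 < hi) (hK : ∀ j ∈ s, 0 < K j)
    (ht : ∀ j ∈ t, lo ≤ K j ∧ K j ≤ hi) (hs : ∀ j ∈ s, j ∉ t → K j ≤ lo + hi)
    (horth : ∑ j ∈ s, (a j - b j) * (K j * a j) = 0) :
    4 * (lo * hi) * ∑ j ∈ t, a j ^ 2 ≤ (lo + hi) ^ 2 * ∑ j ∈ s, b j ^ 2 := by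
  set p := ∑ j ∈ t, a j ^ 2 with hp
  set q := ∑ j ∈ s, (K j * a j) ^ 2 with hq
  set e := ∑ j ∈ s, K j * a j ^ 2 with he
  set B := ∑ j ∈ s, b j ^ 2 with hB
  have hp0 : 0 ≤ p := Finset.sum_nonneg fun j _ => sq_nonneg _
  have hq0 : 0 ≤ q := Finset.sum_nonneg fun j _ => sq_nonneg _
  have hB0 : 0 ≤ B := Finset.sum_nonneg fun j _ => sq_nonneg _
  have he0 : 0 ≤ e := Finset.sum_nonneg fun j hj => mul_nonneg (hK j hj).le (sq_nonneg _)
  have he' : e = ∑ j ∈ s, b j * (K j * a j) := by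
    have : ∑ j ∈ s, (a j - b j) * (K j * a j) = e - ∑ j ∈ s, b j * (K j * a j) := by
      rw [he, ← Finset.sum_sub_distrib]
      exact Finset.sum_congr rfl fun j _ => by ring
    linarith
  have hcs : e ^ 2 ≤ B * q := by
    rw [he']
    exact Finset.sum_mul_sq_le_sq_mul_sq s b (fun j => K j * a j)
  have hlin : q + lo * hi * p ≤ (lo + hi) * e := by
    have h1 : p = ∑ j ∈ s, if j ∈ t then a j ^ 2 else 0 := by
      rw [hp, ← Finset.sum_filter]
      congr 1
      ext j; simp; exact fun h => hts h
    rw [h1, hq, he, Finset.mul_sum, Finset.mul_sum, ← Finset.sum_add_distrib]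
    refine Finset.sum_le_sum fun j hj => ?_
    have hKj := hK j hj
    split_ifs with hjt
    · obtain ⟨h1, h2⟩ := ht j hjt
      have : 0 ≤ (K j - lo) * (hi - K j) * a j ^ 2 :=
        mul_nonneg (mul_nonneg (by linarith) (by linarith)) (sq_nonneg _)
      nlinarith
    · have h1 := hs j hj hjt
      have : 0 ≤ (lo + hi - K j) * K j * a j ^ 2 :=
        mul_nonneg (mul_nonneg (by linarith) hKj.le) (sq_nonneg _)
      nlinarith
  rcases hq0.eq_or_lt with h0 | h0
  · have : p = 0 := by
      have h2 : ∀ j ∈ s, (K j * a j) ^ 2 = 0 :=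
        (Finset.sum_eq_zero_iff_of_nonneg fun j _ => sq_nonneg _).mp h0.symm
      rw [hp]
      refine Finset.sum_eq_zero fun j hj => ?_
      have := h2 j (hts hj)
      have h3 := (hK j (hts hj)).ne'
      have h4 : a j = 0 := by
        have := pow_eq_zero_iff (two_ne_zero) |>.mp this
        rcases mul_eq_zero.mp this with h | h
        · exact absurd h h3
        · exact h
      rw [h4]; norm_num
    rw [this]; simp only [mul_zero]; positivity
  · have h1 : 4 * (lo * hi * p) * q ≤ ((lo + hi) * e) ^ 2 := by
      have : 0 ≤ q + lo * hi * p := by positivity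
      have h3 : (q + lo * hi * p) ^ 2 ≤ ((lo + hi) * e) ^ 2 := by gcongr
      nlinarith [sq_nonneg (q - lo * hi * p)]
    have h2 : (4 * (lo * hi) * p) * q ≤ ((lo + hi) ^ 2 * B) * q := by
      have := mul_le_mul_of_nonneg_left hcs (sq_nonneg (lo + hi))
      nlinarith
    exact le_of_mul_le_mul_right h2 h0

/-- Double Abel summation for matchings. -/
lemma matching_aux (n d : ℕ) (H X : ℕ → ℕ → ℝ)
    (hH0 : ∀ i j, j ≤ i → H i j = 0)
    (hD : ∀ p q, 1 ≤ p → p < q → q ≤ n →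
      0 ≤ H p q - H (p + 1) q - H p (q - 1) + H (p + 1) (q - 1))
    (hX : ∀ p q, 1 ≤ p → p < q → q ≤ n →
      ∑ i ∈ Finset.Icc 1 p, ∑ j ∈ Finset.Icc q n, X i j ≤ ((min (min p (n + 1 - q)) d : ℕ) : ℝ)) :
    ∑ i ∈ Finset.Icc 1 n, ∑ j ∈ Finset.Icc 1 n, X i j * H i j ≤
      ∑ i ∈ Finset.Icc 1 d, H i (n + 1 - i) := by
  set D : ℕ → ℕ → ℝ := fun p q => H p q - H (p + 1) q - H p (q - 1) + H (p + 1) (q - 1) with hDdef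
  have tel1 : ∀ (f : ℕ → ℝ) (j : ℕ), ∑ q ∈ Finset.Icc 1 j, (f q - f (q - 1)) = f j - f 0 := by
    intro f j
    induction j with
    | zero => simp
    | succ j ih => rw [Finset.sum_Icc_succ_top (by omega), ih]; simp
  have tel2 : ∀ (f : ℕ → ℝ) (i l : ℕ), i ≤ l + 1 →
      ∑ p ∈ Finset.Icc i l, (f p - f (p + 1)) = f i - f (l + 1) := by
    intro f i l hil
    induction l with
    | zero =>
      have : i = 0 ∨ i = 1 := by omega
      rcases this with h | h <;> subst h <;> simp
    | succ l ih =>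
      rcases Nat.lt_or_ge (l + 1) i with h | h
      · have : i = l + 1 + 1 := by omega
        subst this; simp
      · rw [Finset.sum_Icc_succ_top h, ih h]; ring
  have hrep : ∀ i j, 1 ≤ i → j ≤ n →
      H i j = ∑ p ∈ Finset.Icc 1 n, ∑ q ∈ Finset.Icc 1 n,
        if i ≤ p ∧ q ≤ j then D p q else 0 := by
    intro i j hi hj
    have h1 : ∀ p, ∑ q ∈ Finset.Icc 1 j, D p q = H p j - H (p + 1) j := by
      intro p
      have := tel1 (fun q => H p q - H (p + 1) q) j
      simp only [hH0 p 0 (by omega), hH0 (p + 1) 0 (by omega)] at this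
      rw [← sub_zero (H p j - H (p + 1) j), ← sub_self (0 : ℝ), ← this]
      exact Finset.sum_congr rfl fun q _ => by simp only [hDdef]; ring
    have h2 : ∀ p, (∑ q ∈ Finset.Icc 1 n, if i ≤ p ∧ q ≤ j then D p q else 0)
        = if i ≤ p then H p j - H (p + 1) j else 0 := by
      intro p
      split_ifs with hp
      · rw [← h1 p]
        simp only [hp, true_and]
        rw [← Finset.sum_filter]
        refine Finset.sum_congr ?_ fun _ _ => rfl
        ext q; simp; omega
      · simp [hp]
    simp only [h2]
    rw [← Finset.sum_filter]
    have h3 : (Finset.Icc 1 n).filter (fun p => i ≤ p) = Finset.Icc i n := by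
      ext p; simp; omega
    rw [h3]
    rcases Nat.lt_or_ge (n + 1) i with h | h
    · rw [Finset.Icc_eq_empty (by omega)]; simp; exact hH0 _ _ (by omega)
    · rw [tel2 (fun p => H p j) i n h, hH0 (n + 1) j (by omega), sub_zero]
  have hL : ∑ i ∈ Finset.Icc 1 n, ∑ j ∈ Finset.Icc 1 n, X i j * H i j =
      ∑ p ∈ Finset.Icc 1 n, ∑ q ∈ Finset.Icc 1 n,
        D p q * ∑ i ∈ Finset.Icc 1 p, ∑ j ∈ Finset.Icc q n, X i j := by
    have e1 : ∀ i ∈ Finset.Icc 1 n, ∀ j ∈ Finset.Icc 1 n, X i j * H i j =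
        ∑ p ∈ Finset.Icc 1 n, ∑ q ∈ Finset.Icc 1 n,
          if i ≤ p ∧ q ≤ j then D p q * X i j else 0 := by
      intro i hi j hj
      rw [Finset.mem_Icc] at hi hj
      rw [hrep i j hi.1 hj.2, Finset.mul_sum]
      refine Finset.sum_congr rfl fun p _ => ?_
      rw [Finset.mul_sum]
      refine Finset.sum_congr rfl fun q _ => ?_
      split_ifs <;> ring
    rw [Finset.sum_congr rfl fun i hi => Finset.sum_congr rfl fun j hj => e1 i hi j hj]
    have e2 : ∀ i ∈ Finset.Icc 1 n, (∑ j ∈ Finset.Icc 1 n, ∑ p ∈ Finset.Icc 1 n,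
        ∑ q ∈ Finset.Icc 1 n, if i ≤ p ∧ q ≤ j then D p q * X i j else 0) =
        ∑ p ∈ Finset.Icc 1 n, ∑ q ∈ Finset.Icc 1 n, ∑ j ∈ Finset.Icc 1 n,
          if i ≤ p ∧ q ≤ j then D p q * X i j else 0 := by
      intro i _
      rw [Finset.sum_comm]
      exact Finset.sum_congr rfl fun p _ => Finset.sum_comm
    rw [Finset.sum_congr rfl e2, Finset.sum_comm]
    refine Finset.sum_congr rfl fun p hp => ?_
    rw [Finset.sum_comm]
    refine Finset.sum_congr rfl fun q hq => ?_
    rw [Finset.mem_Icc] at hp hq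
    rw [Finset.mul_sum]
    have : Finset.Icc 1 p = (Finset.Icc 1 n).filter (fun i => i ≤ p) := by
      ext i; simp; omega
    rw [this, Finset.sum_filter]
    refine Finset.sum_congr rfl fun i hi => ?_
    split_ifs with hip
    · have : Finset.Icc q n = (Finset.Icc 1 n).filter (fun j => q ≤ j) := by
        ext i; simp; omega
      rw [this, Finset.sum_filter, Finset.mul_sum]
      refine Finset.sum_congr rfl fun j hj => ?_
      simp [hip]
    · simp [hip]
  have hR : ∑ i ∈ Finset.Icc 1 d, H i (n + 1 - i) =
      ∑ p ∈ Finset.Icc 1 n, ∑ q ∈ Finset.Icc 1 n,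
        D p q * ((min (min p (n + 1 - q)) d : ℕ) : ℝ) := by
    have e1 : ∀ i ∈ Finset.Icc 1 d, H i (n + 1 - i) =
        ∑ p ∈ Finset.Icc 1 n, ∑ q ∈ Finset.Icc 1 n,
          if i ≤ p ∧ q ≤ n + 1 - i then D p q else 0 := by
      intro i hi
      rw [Finset.mem_Icc] at hi
      exact hrep i _ hi.1 (by omega)
    rw [Finset.sum_congr rfl e1, Finset.sum_comm]
    refine Finset.sum_congr rfl fun p hp => ?_
    rw [Finset.sum_comm]
    refine Finset.sum_congr rfl fun q hq => ?_
    rw [Finset.mem_Icc] at hp hq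
    rw [← Finset.sum_filter, Finset.sum_const, nsmul_eq_mul, mul_comm]
    congr 2
    have : (Finset.Icc 1 d).filter (fun i => i ≤ p ∧ q ≤ n + 1 - i) =
        Finset.Icc 1 (min (min p (n + 1 - q)) d) := by
      ext i; simp; omega
    rw [this]; simp
  rw [hL, hR]
  refine Finset.sum_le_sum fun p hp => Finset.sum_le_sum fun q hq => ?_
  rw [Finset.mem_Icc] at hp hq
  rcases Nat.lt_or_ge p q with h | h
  · exact mul_le_mul_of_nonneg_left (hX p q hp.1 h hq.2) (hD p q hp.1 h hq.2)
  · have : D p q = 0 := by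
      simp only [hDdef]
      rw [hH0 p q h, hH0 (p + 1) q (by omega), hH0 p (q - 1) (by omega),
        hH0 (p + 1) (q - 1) (by omega)]
      ring
    rw [this]; simp

lemma T_posSemidef {n : Type*} [Fintype n] [DecidableEq n] (T : Matrix n n ℝ) (hs : Tᵀ = T)
    (hT : ∀ z, (T *ᵥ z) ⬝ᵥ (T *ᵥ z) ≤ z ⬝ᵥ (T *ᵥ z)) : T.PosSemidef := by
  rw [Matrix.posSemidef_iff_dotProduct_mulVec]
  refine ⟨by rw [Matrix.IsHermitian, Matrix.conjTranspose_eq_transpose_of_trivial, hs], fun x => ?_⟩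
  rw [star_trivial]
  exact le_trans (Finset.sum_nonneg fun i _ => mul_self_nonneg _) (hT x)

lemma T_row {n : Type*} [Fintype n] [DecidableEq n] (T : Matrix n n ℝ) (hs : Tᵀ = T)
    (hT : ∀ z, (T *ᵥ z) ⬝ᵥ (T *ᵥ z) ≤ z ⬝ᵥ (T *ᵥ z)) (i : n) :
    ∑ j, T i j ^ 2 ≤ T i i := by
  have h := hT (Pi.single i 1)
  have hs' : ∀ a b, T a b = T b a := fun a b => by
    conv_lhs => rw [← hs]
    rfl
  simp only [Matrix.mulVec_single_one, single_dotProduct, one_mul] at h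
  calc ∑ j, T i j ^ 2 = T.col i ⬝ᵥ T.col i := by
        simp only [dotProduct, Matrix.col_apply]
        exact Finset.sum_congr rfl fun j _ => by rw [hs' j i, sq]
    _ ≤ _ := h

lemma T_cut_row {n : Type*} [Fintype n] [DecidableEq n] (T : Matrix n n ℝ) (hs : Tᵀ = T)
    (hT : ∀ z, (T *ᵥ z) ⬝ᵥ (T *ᵥ z) ≤ z ⬝ᵥ (T *ᵥ z)) (A B : Finset n) (hAB : Disjoint A B) :
    ∑ i ∈ A, ∑ j ∈ B, 4 * T i j ^ 2 ≤ (A.card : ℝ) := by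
  have : ∀ i ∈ A, ∑ j ∈ B, 4 * T i j ^ 2 ≤ 1 := by
    intro i hi
    have h1 : ∑ j ∈ B, T i j ^ 2 + T i i ^ 2 ≤ ∑ j, T i j ^ 2 := by
      have : i ∉ B := Finset.disjoint_left.mp hAB hi
      rw [add_comm, ← Finset.sum_insert (f := fun j => T i j ^ 2) this]
      exact Finset.sum_le_sum_of_subset_of_nonneg (Finset.subset_univ _) fun _ _ _ => sq_nonneg _
    have h2 := T_row T hs hT i
    rw [← Finset.mul_sum]
    nlinarith [sq_nonneg (2 * T i i - 1)]
  calc _ ≤ ∑ i ∈ A, (1 : ℝ) := Finset.sum_le_sum this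
    _ = _ := by simp

lemma T_cut_tr {n : Type*} [Fintype n] [DecidableEq n] (T : Matrix n n ℝ) (hs : Tᵀ = T)
    (hT : ∀ z, (T *ᵥ z) ⬝ᵥ (T *ᵥ z) ≤ z ⬝ᵥ (T *ᵥ z)) (A B : Finset n) (hAB : Disjoint A B) :
    ∑ i ∈ A, ∑ j ∈ B, 4 * T i j ^ 2 ≤ ∑ i ∈ A ∪ B, ∑ j ∈ A ∪ B, T i j ^ 2 := by
  have hs' : ∀ a b, T a b = T b a := fun a b => by
    conv_lhs => rw [← hs]
    rfl
  have hp := T_posSemidef T hs hT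
  have h2 := ((Matrix.posSemidef_iff_dotProduct_mulVec).mp (hp.hadamard hp)).2
    (fun i => (if i ∈ A then 1 else 0) - (if i ∈ B then 1 else 0))
  rw [star_trivial] at h2
  simp only [dotProduct, Matrix.mulVec, Matrix.hadamard_apply] at h2
  have key : ∀ (C D : Finset n), ∑ i, ((if i ∈ C then (1 : ℝ) else 0) * ∑ j, T i j * T i j * (if j ∈ D then (1 : ℝ) else 0))
      = ∑ i ∈ C, ∑ j ∈ D, T i j ^ 2 := by
    intro C D
    simp [Finset.sum_ite_mem, sq]
  simp only [mul_sub, sub_mul, Finset.sum_sub_distrib] at h2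
  rw [key, key, key, key] at h2
  have hsym : ∑ i ∈ B, ∑ j ∈ A, T i j ^ 2 = ∑ i ∈ A, ∑ j ∈ B, T i j ^ 2 := by
    rw [Finset.sum_comm]
    exact Finset.sum_congr rfl fun i _ => Finset.sum_congr rfl fun j _ => by rw [hs']
  rw [Finset.sum_union hAB]
  simp only [Finset.sum_union hAB, Finset.sum_add_distrib, ← Finset.mul_sum]
  linarith

lemma rows_bound (N k m : ℕ) (hm : 1 ≤ m) (hk2 : 2 ≤ k) (hkN : k ≤ N)
    (lam : Fin N → ℝ) (hmono : StrictMono lam) (hlam0 : lam ⟨0, by omega⟩ = 0)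
    (T : Matrix (Fin N) (Fin N) ℝ) (hs : Tᵀ = T)
    (hT : ∀ z, (T *ᵥ z) ⬝ᵥ (T *ᵥ z) ≤ z ⬝ᵥ (T *ᵥ z))
    (htr : ∑ i ∈ Finset.univ.filter (fun i : Fin N => 1 ≤ i.val),
      ∑ j ∈ Finset.univ.filter (fun i : Fin N => 1 ≤ i.val), T i j ^ 2 ≤ (m : ℝ) - 1) :
    ∑ i ∈ Finset.univ.filter (fun i : Fin N => 1 ≤ i.val),
      ∑ j ∈ Finset.univ.filter (fun i : Fin N => 1 ≤ i.val ∧ i.val < k),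
        T i j ^ 2 * (lam j / lam i) ≤
    ∑ i ∈ Finset.Icc 2 m, omegaFn (max 1 (eig1 lam (k + 2 - i) / eig1 lam i)) := by
  have hs' : ∀ a b, T a b = T b a := fun a b => by
    conv_lhs => rw [← hs]
    rfl
  obtain ⟨d, rfl⟩ : ∃ d, m = d + 1 := ⟨m - 1, by omega⟩
  obtain ⟨n, rfl⟩ : ∃ n, k = n + 1 := ⟨k - 1, by omega⟩
  have hpos : ∀ i : Fin N, 1 ≤ i.val → 0 < lam i := by
    intro i hi
    rw [← hlam0]
    exact hmono (by rw [Fin.lt_def]; simp; omega)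
  set I := Finset.univ.filter (fun i : Fin N => 1 ≤ i.val) with hI
  set K := Finset.univ.filter (fun i : Fin N => 1 ≤ i.val ∧ i.val < n + 1) with hK
  have hKI : K ⊆ I := by intro i; simp [hI, hK]; tauto
  let e : ℕ → Fin N := fun i => if h : i < N then ⟨i, h⟩ else ⟨0, by omega⟩
  have he : ∀ i, i < N → (e i).val = i := by intro i hi; simp [e, hi]
  have hinj : Set.InjOn e (Finset.Icc 1 n : Finset ℕ) := by
    intro a ha b hb hab
    simp only [Finset.coe_Icc, Set.mem_Icc] at ha hb
    have := congrArg Fin.val hab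
    rwa [he a (by omega), he b (by omega)] at this
  have hKim : K = (Finset.Icc 1 n).image e := by
    ext i
    simp only [hK, Finset.mem_filter, Finset.mem_univ, true_and, Finset.mem_image, Finset.mem_Icc]
    constructor
    · intro h
      exact ⟨i.val, by omega, Fin.ext (he _ i.isLt)⟩
    · rintro ⟨a, ha, rfl⟩
      rw [he a (by omega)]; omega
  let a : ℕ → ℝ := fun i => lam (e i)
  have ha_pos : ∀ i, 1 ≤ i → i ≤ n → 0 < a i := fun i h1 h2 => hpos _ (by rw [he i (by omega)]; exact h1)
  have ha_mono : ∀ i j, i ≤ j → j ≤ n → a i ≤ a j := by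
    intro i j hij hj
    exact hmono.monotone (by rw [Fin.le_def, he i (by omega), he j (by omega)]; exact hij)
  have ha_eig : ∀ i, i < N → eig1 lam (i + 1) = a i := by
    intro i hi
    simp [eig1, a, e, hi]
  let h : ℕ → ℕ → ℝ := fun i j => (a j / a i + a i / a j - 2) / 4
  let H : ℕ → ℕ → ℝ := fun i j => if i < j then h i j else 0
  let X : ℕ → ℕ → ℝ := fun i j => 4 * T (e i) (e j) ^ 2
  have hmatch : ∑ i ∈ Finset.Icc 1 n, ∑ j ∈ Finset.Icc 1 n, X i j * H i j ≤
      ∑ i ∈ Finset.Icc 1 d, H i (n + 1 - i) := by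
    apply matching_aux
    · intro i j hij
      simp only [H]; rw [if_neg (by omega)]
    · intro p q hp hpq hq
      have p1 := ha_pos p hp (by omega)
      have p2 := ha_pos (p + 1) (by omega) (by omega)
      have p3 := ha_pos q (by omega) (by omega)
      have m1 := ha_mono p (p + 1) (by omega) (by omega)
      rcases Nat.lt_or_ge (p + 1) q with h1 | h1
      · have p4 := ha_pos (q - 1) (by omega) (by omega)
        have m2 := ha_mono (q - 1) q (by omega) (by omega)
        have hval : H (p + 1) (q - 1) = h (p + 1) (q - 1) := by
          simp only [H]
          by_cases h3 : p + 1 < q - 1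
          · rw [if_pos h3]
          · rw [if_neg h3]
            have : q - 1 = p + 1 := by omega
            simp only [h, this]
            rw [div_self p2.ne']; norm_num
        have e1 : H p q = h p q := if_pos hpq
        have e2 : H (p + 1) q = h (p + 1) q := if_pos h1
        have e3 : H p (q - 1) = h p (q - 1) := if_pos (by omega)
        rw [hval, e1, e2, e3]
        have : h p q - h (p + 1) q - h p (q - 1) + h (p + 1) (q - 1) =
          ((a q - a (q - 1)) * (1 / a p - 1 / a (p + 1)) +
            (a (p + 1) - a p) * (1 / a (q - 1) - 1 / a q)) / 4 := by
          simp only [h]; ring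
        rw [this]
        have i1 : 1 / a (p + 1) ≤ 1 / a p := one_div_le_one_div_of_le p1 m1
        have i2 : 1 / a q ≤ 1 / a (q - 1) := one_div_le_one_div_of_le p4 m2
        have t1 : 0 ≤ (a q - a (q - 1)) * (1 / a p - 1 / a (p + 1)) :=
          mul_nonneg (by linarith) (by linarith)
        have t2 : 0 ≤ (a (p + 1) - a p) * (1 / a (q - 1) - 1 / a q) :=
          mul_nonneg (by linarith) (by linarith)
        linarith
      · have e1 : H p q = h p q := if_pos hpq
        have e2 : H (p + 1) q = 0 := if_neg (by omega)
        have e3 : H p (q - 1) = 0 := if_neg (by omega)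
        have e4 : H (p + 1) (q - 1) = 0 := if_neg (by omega)
        rw [e1, e2, e3, e4]
        have : h p q = (a q - a p) ^ 2 / (a p * a q) / 4 := by
          simp only [h]; field_simp; ring
        rw [this]
        have : 0 ≤ (a q - a p) ^ 2 / (a p * a q) / 4 := by positivity
        linarith
    · intro p q hp hpq hq
      have j1 : Set.InjOn e (Finset.Icc 1 p : Finset ℕ) := hinj.mono (by
        intro x; simp; omega)
      have j2 : Set.InjOn e (Finset.Icc q n : Finset ℕ) := hinj.mono (by
        intro x; simp; omega)
      have s1 : ∑ i ∈ Finset.Icc 1 p, ∑ j ∈ Finset.Icc q n, X i j =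
          ∑ i ∈ (Finset.Icc 1 p).image e, ∑ j ∈ (Finset.Icc q n).image e, 4 * T i j ^ 2 := by
        rw [Finset.sum_image j1]
        refine Finset.sum_congr rfl fun i _ => ?_
        rw [Finset.sum_image j2]
      have hdis : Disjoint ((Finset.Icc 1 p).image e) ((Finset.Icc q n).image e) := by
        rw [Finset.disjoint_left]
        intro x hx hy
        simp only [Finset.mem_image, Finset.mem_Icc] at hx hy
        obtain ⟨b, hb, rfl⟩ := hx
        obtain ⟨c, hc, hbc⟩ := hy
        have := congrArg Fin.val hbc
        rw [he c (by omega), he b (by omega)] at this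
        omega
      have b1 := T_cut_row T hs hT _ _ hdis
      have b2 := T_cut_row T hs hT _ _ hdis.symm
      have b3 := T_cut_tr T hs hT _ _ hdis
      rw [Finset.card_image_of_injOn j1, Nat.card_Icc] at b1
      rw [Finset.card_image_of_injOn j2, Nat.card_Icc, Finset.sum_comm] at b2
      have b2' : ∑ i ∈ (Finset.Icc 1 p).image e, ∑ j ∈ (Finset.Icc q n).image e, 4 * T i j ^ 2
          ≤ ((n + 1 - q : ℕ) : ℝ) := by
        refine le_trans (le_of_eq ?_) b2
        exact Finset.sum_congr rfl fun i _ => Finset.sum_congr rfl fun j _ => by rw [hs']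
      have hsub : (Finset.Icc 1 p).image e ∪ (Finset.Icc q n).image e ⊆ I := by
        refine Finset.Subset.trans ?_ hKI
        rw [hKim, ← Finset.image_union]
        refine Finset.image_subset_image ?_
        intro x; simp; omega
      have b3' : ∑ i ∈ (Finset.Icc 1 p).image e, ∑ j ∈ (Finset.Icc q n).image e, 4 * T i j ^ 2
          ≤ (d : ℝ) := by
        refine b3.trans ?_
        have : ∑ i ∈ I, ∑ j ∈ I, T i j ^ 2 ≤ (d : ℝ) := by
          push_cast at htr; linarith
        refine le_trans ?_ this
        refine le_trans (Finset.sum_le_sum_of_subset_of_nonneg hsub fun _ _ _ =>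
          Finset.sum_nonneg fun _ _ => sq_nonneg _) ?_
        exact Finset.sum_le_sum fun i _ =>
          Finset.sum_le_sum_of_subset_of_nonneg hsub fun _ _ _ => sq_nonneg _
      rw [s1]
      simp only [add_tsub_cancel_right] at b1
      push_cast [Nat.cast_min]
      refine le_min (le_min b1 ?_) b3'
      exact b2'
  have hKK : ∑ i ∈ K, ∑ j ∈ K, T i j ^ 2 * (lam j / lam i) =
      ∑ i ∈ K, ∑ j ∈ K, T i j ^ 2 +
        ∑ i ∈ Finset.Icc 1 n, ∑ j ∈ Finset.Icc 1 n, X i j * H i j := by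
    have c1 : ∀ f : Fin N → Fin N → ℝ, ∑ i ∈ K, ∑ j ∈ K, f i j =
        ∑ i ∈ Finset.Icc 1 n, ∑ j ∈ Finset.Icc 1 n, f (e i) (e j) := by
      intro f
      rw [hKim, Finset.sum_image hinj]
      exact Finset.sum_congr rfl fun i _ => Finset.sum_image hinj
    rw [c1, c1]
    have c2 : ∑ i ∈ Finset.Icc 1 n, ∑ j ∈ Finset.Icc 1 n, X i j * H i j =
        ∑ i ∈ Finset.Icc 1 n, ∑ j ∈ Finset.Icc 1 n, X i j * H j i := by
      rw [Finset.sum_comm]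
      exact Finset.sum_congr rfl fun i _ => Finset.sum_congr rfl fun j _ => by
        simp only [X]; rw [hs']
    have c3 : ∑ i ∈ Finset.Icc 1 n, ∑ j ∈ Finset.Icc 1 n, T (e i) (e j) ^ 2 * (lam (e j) / lam (e i)) =
        ∑ i ∈ Finset.Icc 1 n, ∑ j ∈ Finset.Icc 1 n, T (e i) (e j) ^ 2 * (lam (e i) / lam (e j)) := by
      rw [Finset.sum_comm]
      exact Finset.sum_congr rfl fun i _ => Finset.sum_congr rfl fun j _ => by rw [hs']
    have c4 : ∑ i ∈ Finset.Icc 1 n, ∑ j ∈ Finset.Icc 1 n, T (e i) (e j) ^ 2 * (lam (e j) / lam (e i)) +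
        ∑ i ∈ Finset.Icc 1 n, ∑ j ∈ Finset.Icc 1 n, T (e i) (e j) ^ 2 * (lam (e i) / lam (e j)) =
        2 * ∑ i ∈ Finset.Icc 1 n, ∑ j ∈ Finset.Icc 1 n, T (e i) (e j) ^ 2 +
        ∑ i ∈ Finset.Icc 1 n, ∑ j ∈ Finset.Icc 1 n, X i j * H i j +
        ∑ i ∈ Finset.Icc 1 n, ∑ j ∈ Finset.Icc 1 n, X i j * H j i := by
      rw [Finset.mul_sum]
      simp only [Finset.mul_sum, ← Finset.sum_add_distrib]
      refine Finset.sum_congr rfl fun i hi => Finset.sum_congr rfl fun j hj => ?_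
      rw [Finset.mem_Icc] at hi hj
      have p1 := ha_pos i hi.1 hi.2
      simp only [X, H, h]
      rcases lt_trichotomy i j with g | g | g
      · rw [if_pos g, if_neg (by omega)]; simp only [a]; ring
      · subst g
        have : lam (e i) / lam (e i) = 1 := div_self p1.ne'
        simp only [lt_irrefl, if_false, this]; ring
      · rw [if_pos g, if_neg (by omega)]; simp only [a]; ring
    linarith
  have hsplit : ∑ i ∈ I, ∑ j ∈ K, T i j ^ 2 * (lam j / lam i) ≤
      ∑ i ∈ I, ∑ j ∈ K, T i j ^ 2 +
        ∑ i ∈ Finset.Icc 1 n, ∑ j ∈ Finset.Icc 1 n, X i j * H i j := by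
    rw [← Finset.sum_sdiff hKI, ← Finset.sum_sdiff hKI (f := fun i => ∑ j ∈ K, T i j ^ 2), hKK]
    have : ∑ i ∈ I \ K, ∑ j ∈ K, T i j ^ 2 * (lam j / lam i) ≤ ∑ i ∈ I \ K, ∑ j ∈ K, T i j ^ 2 := by
      refine Finset.sum_le_sum fun i hi => Finset.sum_le_sum fun j hj => ?_
      simp only [hI, hK, Finset.mem_sdiff, Finset.mem_filter, Finset.mem_univ, true_and] at hi hj
      have hp := hpos i hi.1
      have : lam j / lam i ≤ 1 := by
        rw [div_le_one hp]
        exact hmono.monotone (by rw [Fin.le_def]; omega)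
      exact mul_le_of_le_one_right (sq_nonneg _) this
    linarith
  have hIK : ∑ i ∈ I, ∑ j ∈ K, T i j ^ 2 ≤ (d : ℝ) := by
    have h1 : ∑ i ∈ I, ∑ j ∈ K, T i j ^ 2 ≤ ∑ i ∈ I, ∑ j ∈ I, T i j ^ 2 :=
      Finset.sum_le_sum fun i _ =>
          Finset.sum_le_sum_of_subset_of_nonneg hKI fun _ _ _ => sq_nonneg _
    push_cast at htr; linarith
  have hrhs : ∑ i ∈ Finset.Icc 2 (d + 1), omegaFn (max 1 (eig1 lam (n + 1 + 2 - i) / eig1 lam i)) =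
      (d : ℝ) + ∑ i ∈ Finset.Icc 1 d, H i (n + 1 - i) := by
    have : Finset.Icc 2 (d + 1) = (Finset.Icc 1 d).image (fun i => i + 1) := by
      ext x; simp only [Finset.mem_Icc, Finset.mem_image]
      constructor
      · intro hx; exact ⟨x - 1, by omega, by omega⟩
      · rintro ⟨y, hy, rfl⟩; omega
    rw [this, Finset.sum_image (by intro x _ y _ hxy; simpa using hxy)]
    have hd : (d : ℝ) = ∑ i ∈ Finset.Icc 1 d, (1 : ℝ) := by simp
    rw [hd, ← Finset.sum_add_distrib]
    refine Finset.sum_congr rfl fun i hi => ?_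
    rw [Finset.mem_Icc] at hi
    by_cases g : i < n + 1 - i
    · have e1 : n + 1 + 2 - (i + 1) = (n + 1 - i) + 1 := by omega
      rw [e1, ha_eig _ (by omega), ha_eig _ (by omega)]
      have p1 := ha_pos i hi.1 (by omega)
      have p2 := ha_pos (n + 1 - i) (by omega) (by omega)
      have m1 := ha_mono i (n + 1 - i) (by omega) (by omega)
      rw [max_eq_right ((one_le_div p1).mpr m1), omegaFn_eq (by positivity)]
      simp only [H, h]
      rw [if_pos g, one_div_div]
    · simp only [H]
      rw [if_neg g]
      have : eig1 lam (n + 1 + 2 - (i + 1)) / eig1 lam (i + 1) ≤ 1 := by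
        rcases Nat.lt_or_ge i (n + 1) with g1 | g1
        · have e1 : n + 1 + 2 - (i + 1) = (n + 1 - i) + 1 := by omega
          rw [e1, ha_eig _ (by omega), ha_eig _ (by omega)]
          exact (div_le_one (ha_pos i hi.1 (by omega))).mpr (ha_mono _ _ (by omega) (by omega))
        · have : eig1 lam (n + 1 + 2 - (i + 1)) = 0 := by
            have : n + 1 + 2 - (i + 1) - 1 = 0 := by omega
            simp only [eig1, this]
            rw [dif_pos (by omega)]; exact hlam0
          rw [this]; norm_num
      rw [max_eq_left this, omegaFn_one]; ring
  rw [hrhs]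
  linarith

lemma parseval_aux {N : ℕ} (u : Fin N → Fin N → ℝ)
    (hortho : ∀ i j, u i ⬝ᵥ u j = if i = j then (1 : ℝ) else 0) (x y : Fin N → ℝ) :
    x ⬝ᵥ y = ∑ i, (u i ⬝ᵥ x) * (u i ⬝ᵥ y) := by
  have h1 : (Matrix.of u) * (Matrix.of u)ᵀ = 1 := by
    ext i j
    rw [Matrix.mul_apply, Matrix.one_apply, ← hortho i j]
    rfl
  have h2 : (Matrix.of u)ᵀ * (Matrix.of u) = 1 := mul_eq_one_comm.mp h1
  calc x ⬝ᵥ y = x ⬝ᵥ (((Matrix.of u)ᵀ * (Matrix.of u)) *ᵥ y) := by rw [h2, Matrix.one_mulVec]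
    _ = ((Matrix.of u) *ᵥ x) ⬝ᵥ ((Matrix.of u) *ᵥ y) := by
        rw [← Matrix.mulVec_mulVec, Matrix.dotProduct_mulVec, Matrix.vecMul_transpose]
    _ = _ := rfl

lemma symm_dot {n : Type*} [Fintype n] (L : Matrix n n ℝ) (hL : Lᵀ = L) (x y : n → ℝ) :
    x ⬝ᵥ (L *ᵥ y) = (L *ᵥ x) ⬝ᵥ y := by
  rw [Matrix.dotProduct_mulVec, ← Matrix.mulVec_transpose, hL]

lemma eig_dot {N : ℕ} (L : Matrix (Fin N) (Fin N) ℝ) (hL : Lᵀ = L) (lam : Fin N → ℝ)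
    (u : Fin N → Fin N → ℝ) (heig : ∀ i, L *ᵥ (u i) = lam i • u i) (i : Fin N) (x : Fin N → ℝ) :
    u i ⬝ᵥ (L *ᵥ x) = lam i * (u i ⬝ᵥ x) := by
  rw [symm_dot L hL, heig, smul_dotProduct, smul_eq_mul]

lemma quad_dot {N : ℕ} (L : Matrix (Fin N) (Fin N) ℝ) (hL : Lᵀ = L) (lam : Fin N → ℝ)
    (u : Fin N → Fin N → ℝ) (hortho : ∀ i j, u i ⬝ᵥ u j = if i = j then (1 : ℝ) else 0)
    (heig : ∀ i, L *ᵥ (u i) = lam i • u i) (x : Fin N → ℝ) :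
    x ⬝ᵥ (L *ᵥ x) = ∑ i, lam i * (u i ⬝ᵥ x) ^ 2 := by
  rw [parseval_aux u hortho]
  refine Finset.sum_congr rfl fun i _ => ?_
  rw [eig_dot L hL lam u heig]; ring

/-- The sampling matrix. -/
def Pm {N : ℕ} (S : Finset (Fin N)) : Matrix (Fin N) (Fin N) ℝ :=
  Matrix.diagonal fun j => if j ∈ S then 1 else 0

lemma Pm_mulVec {N : ℕ} (S : Finset (Fin N)) (x : Fin N → ℝ) (j : Fin N) :
    (Pm S *ᵥ x) j = if j ∈ S then x j else 0 := by
  simp [Pm, Matrix.mulVec_diagonal]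

lemma Pm_symm {N : ℕ} (S : Finset (Fin N)) : (Pm S)ᵀ = Pm S := by
  simp [Pm]

lemma Pm_quad {N : ℕ} (S : Finset (Fin N)) (x : Fin N → ℝ) :
    x ⬝ᵥ (Pm S *ᵥ x) = ∑ j ∈ S, x j ^ 2 := by
  simp only [dotProduct, Pm_mulVec]
  simp [Finset.sum_ite_mem, sq]

section key
variable {N : ℕ} (L : Matrix (Fin N) (Fin N) ℝ) (hL : Lᵀ = L) (lam : Fin N → ℝ)
    (u : Fin N → Fin N → ℝ) (hortho : ∀ i j, u i ⬝ᵥ u j = if i = j then (1 : ℝ) else 0)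
    (heig : ∀ i, L *ᵥ (u i) = lam i • u i) (hlam : ∀ i, 0 ≤ lam i)
    (z : Fin N) (hz : lam z = 0) (hpos : ∀ i, i ≠ z → 0 < lam i)
    (hconst : ∀ a b, u z a = u z b) (S : Finset (Fin N)) (hS : S.Nonempty) (μ : ℝ) (hμ : 0 < μ)

lemma const_sq {N : ℕ} (u : Fin N → Fin N → ℝ)
    (hortho : ∀ i j, u i ⬝ᵥ u j = if i = j then (1 : ℝ) else 0) (z : Fin N)
    (hconst : ∀ a b, u z a = u z b) (b : Fin N) : (N : ℝ) * u z b ^ 2 = 1 := by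
  have h := hortho z z
  rw [if_pos rfl, dotProduct, Finset.sum_congr rfl fun a _ => by rw [hconst a b]] at h
  simp at h
  rw [sq]; exact h

include hL hortho heig hlam hpos hconst hS hμ in
lemma A_unit : IsUnit (Pm S + μ • L) := by
  rw [← Matrix.mulVec_injective_iff_isUnit]
  have key : ∀ x, (Pm S + μ • L) *ᵥ x = 0 → x = 0 := by
    intro x hx
    have h1 : x ⬝ᵥ ((Pm S + μ • L) *ᵥ x) = 0 := by rw [hx]; simp
    rw [Matrix.add_mulVec, dotProduct_add, Pm_quad, Matrix.smul_mulVec, dotProduct_smul,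
      quad_dot L hL lam u hortho heig, smul_eq_mul] at h1
    have h2 : 0 ≤ ∑ j ∈ S, x j ^ 2 := Finset.sum_nonneg fun _ _ => sq_nonneg _
    have h3' : ∀ i ∈ Finset.univ, 0 ≤ lam i * (u i ⬝ᵥ x) ^ 2 :=
      fun i _ => mul_nonneg (hlam i) (sq_nonneg _)
    have h3 : 0 ≤ ∑ i, lam i * (u i ⬝ᵥ x) ^ 2 := Finset.sum_nonneg h3'
    have h4 : ∑ i, lam i * (u i ⬝ᵥ x) ^ 2 = 0 := by
      have : 0 ≤ μ * ∑ i, lam i * (u i ⬝ᵥ x) ^ 2 := by positivity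
      have : μ * ∑ i, lam i * (u i ⬝ᵥ x) ^ 2 = 0 := by linarith
      rcases mul_eq_zero.mp this with h | h
      · exact absurd h hμ.ne'
      · exact h
    have h5 : ∑ j ∈ S, x j ^ 2 = 0 := by rw [h4] at h1; linarith
    have h6 : ∀ i, i ≠ z → u i ⬝ᵥ x = 0 := by
      intro i hi
      have := (Finset.sum_eq_zero_iff_of_nonneg h3').mp h4 i (Finset.mem_univ _)
      have hp := (hpos i hi).ne'
      simpa [hp] using this
    have h7 : ∀ y : Fin N → ℝ, y ⬝ᵥ x = (u z ⬝ᵥ y) * (u z ⬝ᵥ x) := by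
      intro y
      rw [parseval_aux u hortho]
      refine Finset.sum_eq_single z (fun i _ hi => by rw [h6 i hi, mul_zero]) (by simp)
    have h8 : ∀ j, x j = u z j * (u z ⬝ᵥ x) := by
      intro j
      have := h7 (Pi.single j 1)
      simpa using this
    obtain ⟨s, hs⟩ := hS
    have h9 : x s = 0 := by
      have := (Finset.sum_eq_zero_iff_of_nonneg fun _ _ => sq_nonneg _).mp h5 s hs
      simpa using this
    funext j
    rw [h8 j, hconst j s, ← h8 s, h9]; rfl
  intro x y hxy
  have := key (x - y) (by rw [Matrix.mulVec_sub]; exact sub_eq_zero.mpr hxy)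
  exact sub_eq_zero.mp this

variable (hA : IsUnit (Pm S + μ • L))

include hA in
lemma A_mul_inv (y : Fin N → ℝ) :
    Pm S *ᵥ ((Pm S + μ • L)⁻¹ *ᵥ y) + μ • (L *ᵥ ((Pm S + μ • L)⁻¹ *ᵥ y)) = y := by
  rw [← Matrix.smul_mulVec, ← Matrix.add_mulVec, Matrix.mulVec_mulVec,
    Matrix.mul_nonsing_inv _ ((Matrix.isUnit_iff_isUnit_det _).mp hA), Matrix.one_mulVec]

include hL in
lemma Ainv_symm : ((Pm S + μ • L)⁻¹)ᵀ = (Pm S + μ • L)⁻¹ := by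
  rw [Matrix.transpose_nonsing_inv, Matrix.transpose_add, Matrix.transpose_smul, hL, Pm_symm]

include heig hA in
lemma M_mulVec (j : Fin N) : ((Pm S + μ • L)⁻¹ * Pm S) *ᵥ u j =
    u j - (μ * lam j) • ((Pm S + μ • L)⁻¹ *ᵥ u j) := by
  have h1 : Pm S *ᵥ u j = (Pm S + μ • L) *ᵥ u j - (μ * lam j) • u j := by
    rw [Matrix.add_mulVec, Matrix.smul_mulVec, heig, smul_smul]; simp
  rw [← Matrix.mulVec_mulVec, h1, Matrix.mulVec_sub, Matrix.mulVec_mulVec,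
    Matrix.nonsing_inv_mul _ ((Matrix.isUnit_iff_isUnit_det _).mp hA), Matrix.one_mulVec,
    Matrix.mulVec_smul]

/-- Entries of the reconstruction operator in the eigenbasis. -/
noncomputable def Me (L : Matrix (Fin N) (Fin N) ℝ) (u : Fin N → Fin N → ℝ) (S : Finset (Fin N))
    (μ : ℝ) (i j : Fin N) : ℝ := u i ⬝ᵥ (((Pm S + μ • L)⁻¹ * Pm S) *ᵥ u j)

include hortho heig hA in
lemma Me_eq (i j : Fin N) : Me L u S μ i j = (if i = j then 1 else 0) -
    μ * lam j * (u i ⬝ᵥ ((Pm S + μ • L)⁻¹ *ᵥ u j)) := by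
  rw [Me, M_mulVec L lam u heig S μ hA, dotProduct_sub, hortho, dotProduct_smul, smul_eq_mul]

include hL hortho heig hlam hμ hA in
/-- Energy inequality. -/
lemma energy (y : Fin N → ℝ) :
    ∑ j ∈ S, (((Pm S + μ • L)⁻¹ *ᵥ y) j) ^ 2 +
    μ * ∑ i, lam i * (u i ⬝ᵥ ((Pm S + μ • L)⁻¹ *ᵥ y)) ^ 2 = y ⬝ᵥ ((Pm S + μ • L)⁻¹ *ᵥ y) := by
  set x := (Pm S + μ • L)⁻¹ *ᵥ y with hx
  have h := A_mul_inv L S μ hA y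
  rw [← hx] at h
  rw [← h, add_dotProduct, smul_dotProduct, dotProduct_comm, Pm_quad, dotProduct_comm, 
    quad_dot L hL lam u hortho heig, smul_eq_mul]

include hL hortho heig hlam hμ hA in
lemma Me_diag_nonneg (i : Fin N) : 0 ≤ Me L u S μ i i := by
  rw [Me_eq L lam u hortho heig S μ hA, if_pos rfl]
  set x := (Pm S + μ • L)⁻¹ *ᵥ u i with hx
  have h := energy L hL lam u hortho heig hlam S μ hμ hA (u i)
  rw [← hx] at h
  have h2 : lam i * (u i ⬝ᵥ x) ^ 2 ≤ ∑ i, lam i * (u i ⬝ᵥ x) ^ 2 :=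
    Finset.single_le_sum (f := fun i => lam i * (u i ⬝ᵥ x) ^ 2)
      (fun i _ => mul_nonneg (hlam i) (sq_nonneg _)) (Finset.mem_univ i)
  have h3 : 0 ≤ ∑ j ∈ S, (x j) ^ 2 := Finset.sum_nonneg fun _ _ => sq_nonneg _
  have h4 := mul_le_mul_of_nonneg_left h2 hμ.le
  have h5 : μ * lam i * (u i ⬝ᵥ x) ^ 2 ≤ u i ⬝ᵥ x := by nlinarith
  by_contra hneg
  push Not at hneg
  have h6 : 1 < μ * lam i * (u i ⬝ᵥ x) := by linarith
  have h7 : 0 ≤ u i ⬝ᵥ x := le_trans (mul_nonneg (mul_nonneg hμ.le (hlam i)) (sq_nonneg _)) h5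
  have h8 : 0 < u i ⬝ᵥ x := by
    rcases h7.eq_or_lt with h | h
    · rw [← h] at h6; norm_num at h6
    · exact h
  nlinarith

/-- Symmetrised reconstruction operator in the eigenbasis. -/
noncomputable def Tm (L : Matrix (Fin N) (Fin N) ℝ) (lam : Fin N → ℝ) (u : Fin N → Fin N → ℝ)
    (S : Finset (Fin N)) (μ : ℝ) : Matrix (Fin N) (Fin N) ℝ := Matrix.of fun i j =>
  (if i = j then 1 else 0) -
    μ * (Real.sqrt (lam i) * Real.sqrt (lam j)) * (u i ⬝ᵥ ((Pm S + μ • L)⁻¹ *ᵥ u j))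

include hL in
lemma Tm_symm : (Tm L lam u S μ)ᵀ = Tm L lam u S μ := by
  ext i j
  simp only [Tm, Matrix.transpose_apply, Matrix.of_apply]
  rw [symm_dot _ (Ainv_symm L hL S μ), dotProduct_comm]
  simp only [eq_comm]
  ring

include hL hortho heig hlam hμ hA in
lemma Tm_contr (w : Fin N → ℝ) :
    (Tm L lam u S μ *ᵥ w) ⬝ᵥ (Tm L lam u S μ *ᵥ w) ≤ w ⬝ᵥ (Tm L lam u S μ *ᵥ w) := by
  set y : Fin N → ℝ := ∑ j, (Real.sqrt (lam j) * w j) • u j with hy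
  set x := (Pm S + μ • L)⁻¹ *ᵥ y with hx
  have hTw : ∀ i, (Tm L lam u S μ *ᵥ w) i = w i - μ * Real.sqrt (lam i) * (u i ⬝ᵥ x) := by
    intro i
    have : u i ⬝ᵥ x = ∑ j, (Real.sqrt (lam j) * w j) * (u i ⬝ᵥ ((Pm S + μ • L)⁻¹ *ᵥ u j)) := by
      rw [hx, hy, Matrix.mulVec_sum, dotProduct_sum]
      refine Finset.sum_congr rfl fun j _ => ?_
      rw [Matrix.mulVec_smul, dotProduct_smul, smul_eq_mul]
    rw [this]
    simp only [Tm, Matrix.mulVec, dotProduct, Matrix.of_apply, sub_mul, Finset.sum_sub_distrib]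
    congr 1
    · simp
    · rw [Finset.mul_sum]
      refine Finset.sum_congr rfl fun j _ => ?_
      ring
  have hyx : y ⬝ᵥ x = ∑ j, Real.sqrt (lam j) * w j * (u j ⬝ᵥ x) := by
    rw [hy, sum_dotProduct]
    exact Finset.sum_congr rfl fun j _ => by rw [smul_dotProduct, smul_eq_mul]
  have hen := energy L hL lam u hortho heig hlam S μ hμ hA y
  rw [← hx] at hen
  have h3 : 0 ≤ ∑ j ∈ S, (x j) ^ 2 := Finset.sum_nonneg fun _ _ => sq_nonneg _
  have h4 : w ⬝ᵥ (Tm L lam u S μ *ᵥ w) - (Tm L lam u S μ *ᵥ w) ⬝ᵥ (Tm L lam u S μ *ᵥ w) =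
      μ * (y ⬝ᵥ x) - μ ^ 2 * ∑ i, lam i * (u i ⬝ᵥ x) ^ 2 := by
    rw [hyx]
    have e1 : ∀ v v' : Fin N → ℝ, v ⬝ᵥ v' = ∑ i, v i * v' i := fun _ _ => rfl
    rw [e1 w, e1 (Tm L lam u S μ *ᵥ w), Finset.mul_sum, Finset.mul_sum, ← Finset.sum_sub_distrib,
      ← Finset.sum_sub_distrib]
    refine Finset.sum_congr rfl fun i _ => ?_
    have := Real.sq_sqrt (hlam i)
    rw [hTw]
    linear_combination (-μ ^ 2 * (u i ⬝ᵥ x) ^ 2) * this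
  have h5 : 0 ≤ μ * (y ⬝ᵥ x) - μ ^ 2 * ∑ i, lam i * (u i ⬝ᵥ x) ^ 2 := by
    rw [← hen]
    have : 0 ≤ μ * ∑ j ∈ S, (x j) ^ 2 := by positivity
    nlinarith
  linarith

include hL hortho heig hlam hμ hA in
lemma Tm_trace : ∑ i, Tm L lam u S μ i i ≤ (S.card : ℝ) := by
  have h1 : ∀ i, Tm L lam u S μ i i = u i ⬝ᵥ (((Pm S + μ • L)⁻¹ * Pm S) *ᵥ u i) := by
    intro i
    have := Me_eq L lam u hortho heig S μ hA i i
    rw [Me] at this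
    rw [this]
    simp only [Tm, Matrix.of_apply, Real.mul_self_sqrt (hlam i)]
  have h2 : ∑ i, Tm L lam u S μ i i = Matrix.trace ((Pm S + μ • L)⁻¹ * Pm S) := by
    have hU1 : (Matrix.of u) * (Matrix.of u)ᵀ = 1 := by
      ext i j
      rw [Matrix.mul_apply, Matrix.one_apply, ← hortho i j]
      rfl
    have hU2 : (Matrix.of u)ᵀ * (Matrix.of u) = 1 := mul_eq_one_comm.mp hU1
    calc _ = Matrix.trace ((Matrix.of u) * ((Pm S + μ • L)⁻¹ * Pm S) * (Matrix.of u)ᵀ) := by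
          rw [Matrix.trace]
          refine Finset.sum_congr rfl fun i _ => ?_
          rw [h1, Matrix.diag_apply, Matrix.mul_assoc, Matrix.mul_apply]
          rfl
      _ = _ := by rw [Matrix.trace_mul_comm, ← Matrix.mul_assoc, hU2, Matrix.one_mul]
  rw [h2]
  have h3 : Matrix.trace ((Pm S + μ • L)⁻¹ * Pm S) = ∑ s ∈ S, (Pm S + μ • L)⁻¹ s s := by
    simp only [Matrix.trace, Matrix.diag_apply, Pm, Matrix.mul_diagonal]
    simp [Finset.sum_ite_mem]
  rw [h3]
  have : ∀ s ∈ S, (Pm S + μ • L)⁻¹ s s ≤ 1 := by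
    intro s hs
    have hen := energy L hL lam u hortho heig hlam S μ hμ hA (Pi.single s 1)
    set x := (Pm S + μ • L)⁻¹ *ᵥ (Pi.single s 1) with hx
    have hxs : x s = (Pm S + μ • L)⁻¹ s s := by rw [hx]; simp
    rw [single_dotProduct, one_mul] at hen
    have h4 : x s ^ 2 ≤ ∑ j ∈ S, x j ^ 2 :=
      Finset.single_le_sum (f := fun j => x j ^ 2) (fun _ _ => sq_nonneg _) hs
    have h5 : 0 ≤ μ * ∑ i, lam i * (u i ⬝ᵥ x) ^ 2 :=
      mul_nonneg hμ.le (Finset.sum_nonneg fun i _ => mul_nonneg (hlam i) (sq_nonneg _))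
    rw [← hxs]
    nlinarith
  calc _ ≤ ∑ s ∈ S, (1 : ℝ) := Finset.sum_le_sum this
    _ = _ := by simp

include hL hortho heig hlam hμ hA hz in
lemma Tm_tr_sq : ∑ i ∈ Finset.univ.erase z, ∑ j ∈ Finset.univ.erase z, Tm L lam u S μ i j ^ 2 ≤
    (S.card : ℝ) - 1 := by
  have h1 := Tm_trace L hL lam u hortho heig hlam S μ hμ hA
  have h2 : Tm L lam u S μ z z = 1 := by simp [Tm, hz]
  rw [← Finset.add_sum_erase _ _ (Finset.mem_univ z), h2] at h1
  have h3 : ∀ i ∈ Finset.univ.erase z, ∑ j ∈ Finset.univ.erase z, Tm L lam u S μ i j ^ 2 ≤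
      Tm L lam u S μ i i := by
    intro i _
    refine le_trans ?_ (T_row _ (Tm_symm L hL lam u S μ)
      (Tm_contr L hL lam u hortho heig hlam S μ hμ hA) i)
    exact Finset.sum_le_sum_of_subset_of_nonneg (Finset.subset_univ _) fun _ _ _ => sq_nonneg _
  have := Finset.sum_le_sum h3
  linarith

include hortho heig hA in
lemma Me_sq (hlam : ∀ i, 0 ≤ lam i) (i j : Fin N) (hi : 0 < lam i) :
    Me L u S μ i j ^ 2 = Tm L lam u S μ i j ^ 2 * (lam j / lam i) := by
  rw [Me_eq L lam u hortho heig S μ hA]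
  simp only [Tm, Matrix.of_apply]
  by_cases hij : i = j
  · subst hij
    rw [div_self hi.ne', Real.mul_self_sqrt hi.le, mul_one]
  · simp only [if_neg hij]
    have h1 := Real.sq_sqrt hi.le
    have h2 := Real.sq_sqrt (hlam j)
    rw [zero_sub, zero_sub, neg_sq, neg_sq]
    simp only [mul_pow, h1, h2]
    field_simp

include hL hortho heig hpos hz hconst hS hμ hA in
/-- First-row bound. -/
lemma row0_bound (t : Finset (Fin N)) (hzt : z ∉ t) (l2 lk : ℝ) (hl2 : 0 < l2) (hlk : 0 < lk)
    (ht : ∀ j ∈ t, l2 ≤ lam j ∧ lam j ≤ lk) (hnt : ∀ j, j ≠ z → j ∉ t → lk ≤ lam j) (h2k : l2 ≤ lk) :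
    Me L u S μ z z ^ 2 + ∑ j ∈ t, Me L u S μ z j ^ 2 ≤
      omegaFn (lk / l2) * ((N : ℝ) / (S.card : ℝ)) := by
  set x := (Pm S + μ • L)⁻¹ *ᵥ u z with hx
  set w := Pm S *ᵥ x with hw
  obtain ⟨s, hs⟩ := hS
  set c := u z s with hc
  have hcc : ∀ b, u z b = c := fun b => hconst b s
  have hcN : (N : ℝ) * c ^ 2 = 1 := const_sq u hortho z hconst s
  have hc0 : c ≠ 0 := by intro h; rw [h] at hcN; norm_num at hcN
  have hcard : (0 : ℝ) < S.card := by exact_mod_cast Finset.card_pos.mpr ⟨s, hs⟩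
  set w0 : Fin N → ℝ := fun j => if j ∈ S then 1 / (c * S.card) else 0 with hw0
  have hAx : w + μ • (L *ᵥ x) = u z := A_mul_inv L S μ hA (u z)
  have hwj : ∀ j, u j ⬝ᵥ w = (if j = z then 1 else 0) - μ * lam j * (u j ⬝ᵥ x) := by
    intro j
    have : w = u z - μ • (L *ᵥ x) := by rw [← hAx]; simp
    rw [this, dotProduct_sub, hortho, dotProduct_smul, eig_dot L hL lam u heig, smul_eq_mul]
    ring
  have hMe : ∀ j, Me L u S μ z j = u j ⬝ᵥ w := by
    intro j
    rw [Me, ← Matrix.mulVec_mulVec, symm_dot _ (Ainv_symm L hL S μ), ← hx,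
      symm_dot _ (Pm_symm S), ← hw, dotProduct_comm]
  have hwz : u z ⬝ᵥ w = 1 := by rw [hwj, hz]; simp
  have hw0z : u z ⬝ᵥ w0 = 1 := by
    simp only [dotProduct, hw0, hcc]
    simp [Finset.sum_ite_mem]
    field_simp
  have hw0sq : w0 ⬝ᵥ w0 = (N : ℝ) / S.card := by
    simp only [dotProduct, hw0]
    simp [Finset.sum_ite_mem]
    field_simp
    linarith
  have horth : (w - w0) ⬝ᵥ (x - w) = 0 := by
    refine Finset.sum_eq_zero fun j _ => ?_
    simp only [Pi.sub_apply, hw, Pm_mulVec, hw0]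
    split_ifs <;> ring
  set K : Fin N → ℝ := fun j => μ + 1 / lam j with hK
  set lo := μ + 1 / lk with hlo
  set hi := (lk / l2) * lo with hhi
  have hlo0 : 0 < lo := by positivity
  have hhi0 : 0 < hi := by positivity
  have hhi2 : μ + 1 / l2 ≤ hi := by
    have e : hi = μ * (lk / l2) + 1 / l2 := by rw [hhi, hlo]; field_simp
    have : 1 ≤ lk / l2 := (one_le_div hl2).mpr h2k
    rw [e]; nlinarith
  have hkant := kant_aux (Finset.univ.erase z) t
    (by intro j hj; simp; rintro rfl; exact hzt hj) K (fun j => u j ⬝ᵥ w) (fun j => u j ⬝ᵥ w0)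
    lo hi hlo0 hhi0
    (by intro j hj; have := hpos j (Finset.ne_of_mem_erase hj); simp only [hK]; positivity)
    (by
      intro j hj
      obtain ⟨h1, h2⟩ := ht j hj
      have hj0 : 0 < lam j := lt_of_lt_of_le hl2 h1
      have a1 := one_div_le_one_div_of_le hj0 h2
      have a2 := one_div_le_one_div_of_le hl2 h1
      simp only [hK]
      constructor <;> linarith)
    (by
      intro j hj hjt
      have a1 := one_div_le_one_div_of_le hlk (hnt j (Finset.ne_of_mem_erase hj) hjt)
      simp only [hK]; linarith)
    (by
      rw [parseval_aux u hortho, ← Finset.add_sum_erase _ _ (Finset.mem_univ z),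
        dotProduct_sub (u z) w w0, hwz, hw0z, sub_self, zero_mul, zero_add] at horth
      have : ∑ j ∈ Finset.univ.erase z, (u j ⬝ᵥ w - u j ⬝ᵥ w0) * (K j * (u j ⬝ᵥ w)) =
          (-μ) * ∑ i ∈ Finset.univ.erase z, u i ⬝ᵥ (w - w0) * u i ⬝ᵥ (x - w) := by
        rw [Finset.mul_sum]
        refine Finset.sum_congr rfl fun j hj => ?_
        have hjz := Finset.ne_of_mem_erase hj
        have hj0 := hpos j hjz
        rw [dotProduct_sub, dotProduct_sub, ]
        have e1 := hwj j
        rw [if_neg hjz] at e1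
        have e2 : K j * (u j ⬝ᵥ w) = -μ * (u j ⬝ᵥ x - u j ⬝ᵥ w) := by
          simp only [hK]
          rw [e1]; field_simp; ring
        rw [e2]; ring
      rw [this, horth, mul_zero])
  have hpw : (N : ℝ) / S.card = 1 + ∑ j ∈ Finset.univ.erase z, (u j ⬝ᵥ w0) ^ 2 := by
    rw [← hw0sq, parseval_aux u hortho, ← Finset.add_sum_erase _ _ (Finset.mem_univ z), hw0z]
    simp [sq]
  rw [Finset.sum_congr rfl fun j _ => by rw [hMe j], hMe, hwz, hpw]
  have hw1 : 1 ≤ omegaFn (lk / l2) := one_le_omegaFn (by positivity)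
  have hom : (lo + hi) ^ 2 = omegaFn (lk / l2) * (4 * (lo * hi)) := by
    rw [omegaFn_eq (by positivity), hhi]
    field_simp
    ring
  rw [hom] at hkant
  have h4 : 0 < 4 * (lo * hi) := by positivity
  have : ∑ j ∈ t, (u j ⬝ᵥ w) ^ 2 ≤ omegaFn (lk / l2) * ∑ j ∈ Finset.univ.erase z, (u j ⬝ᵥ w0) ^ 2 := by
    refine le_of_mul_le_mul_left ?_ h4
    linarith
  linarith

end key

lemma frobSq_eq {N k : ℕ} (u : Fin N → Fin N → ℝ)
    (hortho : ∀ i j, u i ⬝ᵥ u j = if i = j then (1 : ℝ) else 0) (B : Matrix (Fin N) (Fin k) ℝ) :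
    frobSq B = ∑ j, ∑ i, (u i ⬝ᵥ B.col j) ^ 2 := by
  rw [frobSq, Matrix.trace]
  refine Finset.sum_congr rfl fun j _ => ?_
  have : (Bᵀ * B).diag j = B.col j ⬝ᵥ B.col j := by
    rw [Matrix.diag_apply, Matrix.mul_apply]; rfl
  rw [this, parseval_aux u hortho]
  exact Finset.sum_congr rfl fun i _ => (sq _).symm

lemma frobSq_mul_U {N : ℕ} (u : Fin N → Fin N → ℝ)
    (hortho : ∀ i j, u i ⬝ᵥ u j = if i = j then (1 : ℝ) else 0) (B : Matrix (Fin N) (Fin N) ℝ) :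
    frobSq B = ∑ j, ∑ i, (u i ⬝ᵥ (B *ᵥ u j)) ^ 2 := by
  have hU1 : (Matrix.of u) * (Matrix.of u)ᵀ = 1 := by
    ext i j
    rw [Matrix.mul_apply, Matrix.one_apply, ← hortho i j]
    rfl
  have hU2 : (Matrix.of u)ᵀ * (Matrix.of u) = 1 := mul_eq_one_comm.mp hU1
  have h1 : frobSq (B * (Matrix.of u)ᵀ) = frobSq B := by
    rw [frobSq, frobSq, Matrix.trace_mul_comm, Matrix.transpose_mul, Matrix.transpose_transpose,
      Matrix.mul_assoc, ← Matrix.mul_assoc (Matrix.of u)ᵀ, hU2, Matrix.one_mul,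
      Matrix.trace_mul_comm]
  rw [← h1, frobSq_eq u hortho]
  rfl

lemma sum_castLE {N k : ℕ} (hkN : k ≤ N) (f : Fin N → ℝ) :
    ∑ j : Fin k, f (Fin.castLE hkN j) = ∑ j ∈ Finset.univ.filter (fun j : Fin N => j.val < k), f j := by
  refine Finset.sum_bij (fun j _ => Fin.castLE hkN j) ?_ ?_ ?_ ?_
  · intro a _; simp
  · intro a _ b _ h; exact Fin.castLE_injective hkN h
  · intro b hb
    simp only [Finset.mem_filter, Finset.mem_univ, true_and] at hb
    exact ⟨⟨b.val, hb⟩, Finset.mem_univ _, rfl⟩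
  · intro a _; rfl

lemma Me_sum_bound {N k : ℕ} (hk2 : 2 ≤ k) (hkN : k ≤ N)
    (L : Matrix (Fin N) (Fin N) ℝ) (hL : Lᵀ = L)
    (lam : Fin N → ℝ) (hmono : StrictMono lam) (hlam0 : lam ⟨0, by omega⟩ = 0)
    (u : Fin N → Fin N → ℝ)
    (hortho : ∀ i j, u i ⬝ᵥ u j = if i = j then (1 : ℝ) else 0)
    (heig : ∀ i, L *ᵥ (u i) = lam i • u i)
    (hconst : ∀ a b, u ⟨0, by omega⟩ a = u ⟨0, by omega⟩ b)
    (S : Finset (Fin N)) (hS : S.Nonempty) (μ : ℝ) (hμ : 0 < μ) :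
    ∑ j : Fin k, ∑ i, Me L u S μ i (Fin.castLE hkN j) ^ 2 ≤ Bbl lam k S.card := by
  set z : Fin N := ⟨0, by omega⟩ with hz
  have hpos : ∀ i, i ≠ z → 0 < lam i := by
    intro i hi
    rw [← hlam0]
    exact hmono (by
      rw [Fin.lt_def]
      have : i.val ≠ 0 := fun h => hi (Fin.ext h)
      exact Nat.pos_of_ne_zero this)
  have hlam : ∀ i, 0 ≤ lam i := by
    intro i
    by_cases h : i = z
    · rw [h, hlam0]
    · exact (hpos i h).le
  have hA := A_unit L hL lam u hortho heig hlam z hpos hconst S hS μ hμ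
  have hI : Finset.univ.filter (fun i : Fin N => 1 ≤ i.val) = Finset.univ.erase z := by
    ext i
    simp only [Finset.mem_filter, Finset.mem_univ, true_and, Finset.mem_erase, and_true, ne_eq,
      Fin.ext_iff, hz]
    omega
  set K := Finset.univ.filter (fun i : Fin N => 1 ≤ i.val ∧ i.val < k) with hK
  have hzK : z ∉ K := by simp [hK, hz]
  have hK0 : Finset.univ.filter (fun j : Fin N => j.val < k) = insert z K := by
    ext i
    simp only [hK, Finset.mem_filter, Finset.mem_univ, true_and, Finset.mem_insert, Fin.ext_iff, hz]
    omega
  have hrows := rows_bound N k S.card (Finset.card_pos.mpr hS) hk2 hkN lam hmono hlam0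
    (Tm L lam u S μ) (Tm_symm L hL lam u S μ) (Tm_contr L hL lam u hortho heig hlam S μ hμ hA)
    (by rw [hI]; exact Tm_tr_sq L hL lam u hortho heig hlam z hlam0 S μ hμ hA)
  rw [hI, ← hK] at hrows
  have h2 : eig1 lam 2 = lam ⟨1, by omega⟩ := by
    simp only [eig1]; rw [dif_pos (by omega)]
  have hk : eig1 lam k = lam ⟨k - 1, by omega⟩ := by
    simp only [eig1]; rw [dif_pos (by omega)]
  have hrow0 := row0_bound L hL lam u hortho heig z hlam0 hpos hconst S hS μ hμ hA K hzK
    (eig1 lam 2) (eig1 lam k)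
    (by rw [h2]; exact hpos _ (by simp [hz])) (by rw [hk]; exact hpos _ (by simp [hz]; omega))
    (by
      intro j hj
      simp only [hK, Finset.mem_filter, Finset.mem_univ, true_and] at hj
      rw [h2, hk]
      constructor <;> refine hmono.monotone ?_ <;> rw [Fin.le_def] <;> simp <;> omega)
    (by
      intro j hjz hj
      have : j.val ≠ 0 := fun h => hjz (Fin.ext h)
      simp only [hK, Finset.mem_filter, Finset.mem_univ, true_and] at hj
      rw [hk]
      refine hmono.monotone ?_; rw [Fin.le_def]; simp; omega)
    (by rw [h2, hk]; refine hmono.monotone ?_; rw [Fin.le_def]; simp; omega)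
  rw [sum_castLE hkN (fun j => ∑ i, Me L u S μ i j ^ 2), Finset.sum_comm, hK0,
    ← Finset.add_sum_erase _ _ (Finset.mem_univ z), Finset.sum_insert hzK]
  have hrest : ∑ i ∈ Finset.univ.erase z, ∑ j ∈ insert z K, Me L u S μ i j ^ 2 =
      ∑ i ∈ Finset.univ.erase z, ∑ j ∈ K, Tm L lam u S μ i j ^ 2 * (lam j / lam i) := by
    refine Finset.sum_congr rfl fun i hi => ?_
    have hi0 := hpos i (Finset.ne_of_mem_erase hi)
    rw [Finset.sum_insert hzK, Me_sq L lam u hortho heig S μ hA hlam i z hi0, hlam0, zero_div,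
      mul_zero, zero_add]
    exact Finset.sum_congr rfl fun j _ => Me_sq L lam u hortho heig S μ hA hlam i j hi0
  rw [hrest, Bbl]
  exact add_le_add hrow0 hrows

lemma Me_univ {N : ℕ} (L : Matrix (Fin N) (Fin N) ℝ) 
    (lam : Fin N → ℝ) (u : Fin N → Fin N → ℝ)
    (hortho : ∀ i j, u i ⬝ᵥ u j = if i = j then (1 : ℝ) else 0)
    (heig : ∀ i, L *ᵥ (u i) = lam i • u i) (hlam : ∀ i, 0 ≤ lam i) (μ : ℝ) (hμ : 0 < μ)
    (hA : IsUnit (Pm Finset.univ + μ • L)) (i j : Fin N) :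
    Me L u Finset.univ μ i j = if i = j then (1 + μ * lam j)⁻¹ else 0 := by
  have h1 : Pm (Finset.univ : Finset (Fin N)) = 1 := by simp [Pm]
  have h2 : (Pm Finset.univ + μ • L) *ᵥ u j = (1 + μ * lam j) • u j := by
    rw [h1, Matrix.add_mulVec, Matrix.one_mulVec, Matrix.smul_mulVec, heig, smul_smul, add_smul,
      one_smul]
  have h0 : 1 + μ * lam j ≠ 0 := by
    have := mul_nonneg hμ.le (hlam j); positivity
  have h3 : (Pm Finset.univ + μ • L)⁻¹ *ᵥ u j = (1 + μ * lam j)⁻¹ • u j := by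
    have : u j = (1 + μ * lam j)⁻¹ • ((Pm Finset.univ + μ • L) *ᵥ u j) := by
      rw [h2, smul_smul, inv_mul_cancel₀ h0, one_smul]
    conv_lhs => rw [this]
    rw [Matrix.mulVec_smul, Matrix.mulVec_mulVec,
      Matrix.nonsing_inv_mul _ ((Matrix.isUnit_iff_isUnit_det _).mp hA), Matrix.one_mulVec]
  have h4 : ((Pm Finset.univ + μ • L)⁻¹ * Pm Finset.univ) *ᵥ u j = (1 + μ * lam j)⁻¹ • u j := by
    rw [← h3]; congr 1; conv_lhs => rw [h1, Matrix.mul_one]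
    rw [h1]
  rw [Me, h4, dotProduct_smul, hortho, smul_eq_mul]
  split_ifs <;> simp

lemma Bbl_pos {N : ℕ} (lam : Fin N → ℝ) (k m : ℕ) (hN : 1 ≤ N) (hm : 1 ≤ m)
    (h : 0 < eig1 lam k / eig1 lam 2) : (m : ℝ) - 1 ≤ ∑ i ∈ Finset.Icc 2 m, omegaFn (max 1 (eig1 lam (k + 2 - i) / eig1 lam i)) ∧ 0 < Bbl lam k m := by
  have h1 : ∀ i ∈ Finset.Icc 2 m, 1 ≤ omegaFn (max 1 (eig1 lam (k + 2 - i) / eig1 lam i)) :=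
    fun i _ => one_le_omegaFn (lt_of_lt_of_le one_pos (le_max_left _ _))
  have h2 := one_le_omegaFn h
  have h3 := Finset.sum_le_sum h1
  simp only [Finset.sum_const, Nat.card_Icc, nsmul_eq_mul, mul_one] at h3
  have h4 : ((m + 1 - 2 : ℕ) : ℝ) = (m : ℝ) - 1 := by
    have : m + 1 - 2 = m - 1 := by omega
    rw [this, Nat.cast_sub hm]; simp
  rw [h4] at h3
  refine ⟨h3, ?_⟩
  have h5 : (1 : ℝ) ≤ m := by exact_mod_cast hm
  have h6 : (0 : ℝ) < N := by exact_mod_cast hN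
  rw [Bbl]
  have : 0 < omegaFn (eig1 lam k / eig1 lam 2) * ((N : ℝ) / (m : ℝ)) := by positivity
  linarith

lemma mopt_le {N : ℕ} (hN : 2 ≤ N) (lam : Fin N → ℝ) (hmono : StrictMono lam)
    (hlam0 : lam ⟨0, by omega⟩ = 0) (m : ℕ) (hm1 : 1 ≤ m) (hmN : m ≤ N)
    (hmin : ∀ m' ∈ Finset.Icc 1 N, Bfull lam m ≤ Bfull lam m') (hB : Bfull lam m < (N : ℝ)) :
    m ≤ (N + 2) / 2 := by
  by_contra hcon
  push Not at hcon
  set c := (N + 2) / 2 with hc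
  have hpos : ∀ j, 2 ≤ j → j ≤ N → 0 < eig1 lam j := by
    intro j h1 h2
    simp only [eig1]; rw [dif_pos (by omega), ← hlam0]
    exact hmono (by rw [Fin.lt_def]; simp; omega)
  have h2 := hmin c (by rw [Finset.mem_Icc]; omega)
  have hr : 0 < eig1 lam N / eig1 lam 2 := div_pos (hpos N hN le_rfl) (hpos 2 le_rfl hN)
  obtain ⟨hs, _⟩ := Bbl_pos lam N m (by omega) hm1 hr
  set r := omegaFn (eig1 lam N / eig1 lam 2) with hrdef
  have hr1 : 1 ≤ r := one_le_omegaFn hr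
  have hsplit : ∑ i ∈ Finset.Icc 2 m, omegaFn (max 1 (eig1 lam (N + 2 - i) / eig1 lam i)) =
      ∑ i ∈ Finset.Icc 2 c, omegaFn (max 1 (eig1 lam (N + 2 - i) / eig1 lam i)) +
        ((m : ℝ) - c) := by
    have hsub : Finset.Icc 2 c ⊆ Finset.Icc 2 m := by intro x; simp; omega
    rw [← Finset.sum_sdiff hsub, add_comm]
    congr 1
    have : ∀ i ∈ Finset.Icc 2 m \ Finset.Icc 2 c,
        omegaFn (max 1 (eig1 lam (N + 2 - i) / eig1 lam i)) = 1 := by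
      intro i hi
      simp only [Finset.mem_sdiff, Finset.mem_Icc] at hi
      rw [max_eq_left, omegaFn_one]
      rw [div_le_one (hpos i (by omega) (by omega))]
      simp only [eig1]
      rw [dif_pos (by omega), dif_pos (by omega)]
      exact hmono.monotone (by rw [Fin.le_def]; simp; omega)
    rw [Finset.sum_congr rfl this, Finset.sum_const, Finset.card_sdiff_of_subset hsub, Nat.card_Icc,
      Nat.card_Icc, nsmul_eq_mul, mul_one]
    have : m + 1 - 2 - (c + 1 - 2) = m - c := by omega
    rw [this, Nat.cast_sub hcon.le]
  have hm0 : (0 : ℝ) < m := by exact_mod_cast hm1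
  have hc0 : (0 : ℝ) < c := by exact_mod_cast (by omega : 0 < c)
  have hmc : (c : ℝ) + 1 ≤ m := by exact_mod_cast hcon
  have hNc : (N : ℝ) + 1 ≤ 2 * c := by exact_mod_cast (by omega : N + 1 ≤ 2 * c)
  simp only [Bfull] at h2 hB
  rw [← hrdef] at h2 hB
  rw [hsplit] at h2
  have hb1 : r * ((N : ℝ) / m) < c := by linarith
  have hb2 : r * ((N : ℝ) / c) * c = r * ((N : ℝ) / m) * m := by field_simp
  set p := r * ((N : ℝ) / m)
  set q := r * ((N : ℝ) / c)
  have h3 : p + (m - c) ≤ q := by linarith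
  nlinarith

/-- Paper's Theorem 4 (`main_GLR_exist`) for GLR under full-band noise, with the explicit
constants `μ_ub` and `τ_GLR` from the Appendix proof: if `m_opt` minimises `B` over
`{1, …, N}` and `B(m_opt) < N`, then `μ_ub > 0`, `m_opt ≤ ⌈(N+1)/2⌉`, and for every
`0 < μ' < μ_ub`, `τ_GLR(μ') > 0` and for every `0 < SNR < τ_GLR(μ')` any sample set of
size `m_opt` is better than full observation. -/
theorem stmt_16 (N k : ℕ) (hN : 2 ≤ N) (hk2 : 2 ≤ k) (hkN : k ≤ N)
    (G : SimpleGraph (Fin N)) [DecidableRel G.Adj] (hG : G.Connected)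
    (lam : Fin N → ℝ) (hmono : StrictMono lam) (hlam0 : lam ⟨0, by omega⟩ = 0)
    (u : Fin N → Fin N → ℝ)
    (hortho : ∀ i j, u i ⬝ᵥ u j = if i = j then (1 : ℝ) else 0)
    (heig : ∀ i, (G.lapMatrix ℝ).mulVec (u i) = lam i • u i)
    (mopt : ℕ) (hmopt : mopt ∈ Finset.Icc 1 N)
    (hmin : ∀ m ∈ Finset.Icc 1 N, Bfull lam mopt ≤ Bfull lam m)
    (hB : Bfull lam mopt < (N : ℝ)) :
    let L := G.lapMatrix ℝ
    let UK : Matrix (Fin N) (Fin k) ℝ := Matrix.of fun i j => u (Fin.castLE hkN j) i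
    let P : Finset (Fin N) → Matrix (Fin N) (Fin N) ℝ :=
      fun T => Matrix.diagonal fun j => if j ∈ T then 1 else 0
    let xi1 : ℝ → Finset (Fin N) → ℝ :=
      fun μ' T => frobSq (UK - (P T + μ' • L)⁻¹ * P T * UK)
    let xi2 : ℝ → Finset (Fin N) → ℝ :=
      fun μ' T => frobSq ((P T + μ' • L)⁻¹ * P T)
    let lamBar := Matrix.trace L / (N : ℝ)
    let μub := (Real.sqrt ((N : ℝ) / Bfull lam mopt) - 1) / lamBar
    let τGLR : ℝ → ℝ := fun μ' =>
      ((k : ℝ) / (N : ℝ)) *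
          ((∑ i : Fin N, ((1 + μ' * lam i)⁻¹) ^ 2) - Bfull lam mopt) /
        ((k : ℝ) + Bbl lam k mopt -
          ∑ j : Fin k, (1 - (1 + μ' * lam (Fin.castLE hkN j))⁻¹) ^ 2)
    0 < μub ∧ mopt ≤ ⌈((N : ℝ) + 1) / 2⌉₊ ∧
    ∀ μ', 0 < μ' → μ' < μub →
      0 < τGLR μ' ∧
      ∀ SNR, 0 < SNR → SNR < τGLR μ' →
        ∀ S : Finset (Fin N), S.card = mopt →
          xi1 μ' S + ((k : ℝ) / ((N : ℝ) * SNR)) * xi2 μ' S <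
            xi1 μ' Finset.univ + ((k : ℝ) / ((N : ℝ) * SNR)) * xi2 μ' Finset.univ := by
  intro L UK P xi1 xi2 lamBar μub τGLR
  have hL : Lᵀ = L := G.isSymm_lapMatrix ℝ
  rw [Finset.mem_Icc] at hmopt
  obtain ⟨hm1, hmN⟩ := hmopt
  have hN0 : (0 : ℝ) < N := by exact_mod_cast (by omega : 0 < N)
  have hk0 : (0 : ℝ) < k := by exact_mod_cast (by omega : 0 < k)
  set z : Fin N := ⟨0, by omega⟩ with hz
  have hpos : ∀ i, i ≠ z → 0 < lam i := by
    intro i hi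
    rw [← hlam0]
    exact hmono (by
      rw [Fin.lt_def]
      have : i.val ≠ 0 := fun h => hi (Fin.ext h)
      exact Nat.pos_of_ne_zero this)
  have hlam : ∀ i, 0 ≤ lam i := by
    intro i
    by_cases h : i = z
    · rw [h, hlam0]
    · exact (hpos i h).le
  have hconst : ∀ a b, u z a = u z b := by
    have h1 : G.lapMatrix ℝ *ᵥ u z = 0 := by
      have := heig z
      rw [hlam0, zero_smul] at this; exact this
    intro a b
    exact (G.lapMatrix_mulVec_eq_zero_iff_forall_reachable.mp h1) a b (hG.preconnected a b)
  have heigpos : ∀ j, 2 ≤ j → j ≤ N → 0 < eig1 lam j := by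
    intro j h1 h2
    simp only [eig1]; rw [dif_pos (by omega)]
    exact hpos _ (by simp [hz]; omega)
  have hBpos : 0 < Bfull lam mopt := (Bbl_pos lam N mopt (by omega) hm1
    (div_pos (heigpos N hN le_rfl) (heigpos 2 le_rfl hN))).2
  have hBkpos : 0 < Bbl lam k mopt := (Bbl_pos lam k mopt (by omega) hm1
    (div_pos (heigpos k hk2 hkN) (heigpos 2 le_rfl hN))).2
  have htr : Matrix.trace L = ∑ i, lam i := by
    have hU1 : (Matrix.of u) * (Matrix.of u)ᵀ = 1 := by
      ext i j
      rw [Matrix.mul_apply, Matrix.one_apply, ← hortho i j]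
      rfl
    have hU2 : (Matrix.of u)ᵀ * (Matrix.of u) = 1 := mul_eq_one_comm.mp hU1
    calc Matrix.trace L = Matrix.trace ((Matrix.of u) * L * (Matrix.of u)ᵀ) := by
          rw [Matrix.trace_mul_comm, ← Matrix.mul_assoc, hU2, Matrix.one_mul]
      _ = ∑ i, u i ⬝ᵥ (L *ᵥ u i) := by
          rw [Matrix.trace]
          refine Finset.sum_congr rfl fun i _ => ?_
          rw [Matrix.diag_apply, Matrix.mul_assoc, Matrix.mul_apply]
          rfl
      _ = _ := by
          refine Finset.sum_congr rfl fun i _ => ?_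
          rw [heig i, dotProduct_smul, hortho]; simp
  have hlb : 0 < lamBar := by
    have : 0 < ∑ i, lam i := Finset.sum_pos' (fun i _ => hlam i)
      ⟨⟨1, by omega⟩, Finset.mem_univ _, hpos _ (by simp [hz])⟩
    simp only [lamBar]; rw [htr]; positivity
  have hsq1 : 1 < Real.sqrt ((N : ℝ) / Bfull lam mopt) := by
    rw [Real.lt_sqrt (by norm_num), one_pow, one_lt_div hBpos]; exact hB
  refine ⟨div_pos (by linarith) hlb, ?_, ?_⟩
  · have h1 := mopt_le hN lam hmono hlam0 mopt hm1 hmN hmin hB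
    have h2 : (N + 2) / 2 ≤ ⌈((N : ℝ) + 1) / 2⌉₊ := by
      have h3 : ((N : ℝ) + 1) / 2 ≤ ⌈((N : ℝ) + 1) / 2⌉₊ := Nat.le_ceil _
      have h4 : ((N + 1 : ℕ) : ℝ) ≤ ((2 * ⌈((N : ℝ) + 1) / 2⌉₊ : ℕ) : ℝ) := by
        push_cast; linarith
      have h5 : N + 1 ≤ 2 * ⌈((N : ℝ) + 1) / 2⌉₊ := by exact_mod_cast h4
      omega
    omega
  · intro μ' hμ hμub
    have hden_k : ∑ j : Fin k, (1 - (1 + μ' * lam (Fin.castLE hkN j))⁻¹) ^ 2 ≤ (k : ℝ) := by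
      calc _ ≤ ∑ j : Fin k, (1 : ℝ) := by
            refine Finset.sum_le_sum fun j _ => ?_
            have h1 : 1 ≤ 1 + μ' * lam (Fin.castLE hkN j) := by
              have := mul_nonneg hμ.le (hlam (Fin.castLE hkN j)); linarith
            have h2 : (1 + μ' * lam (Fin.castLE hkN j))⁻¹ ≤ 1 := inv_le_one_of_one_le₀ h1
            have h3 : 0 < (1 + μ' * lam (Fin.castLE hkN j))⁻¹ := by positivity
            nlinarith
        _ = k := by simp
    have hden : 0 < (k : ℝ) + Bbl lam k mopt -
          ∑ j : Fin k, (1 - (1 + μ' * lam (Fin.castLE hkN j))⁻¹) ^ 2 := by linarith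
    have hnum : 0 < (∑ i : Fin N, ((1 + μ' * lam i)⁻¹) ^ 2) - Bfull lam mopt := by
      set c := 1 + μ' * lamBar with hc
      have hc1 : 0 < c := by positivity
      have hcs : c < Real.sqrt ((N : ℝ) / Bfull lam mopt) := by
        have := (lt_div_iff₀ hlb).mp hμub
        linarith
      have hcB : Bfull lam mopt < N * (c⁻¹) ^ 2 := by
        have h1 := (Real.lt_sqrt hc1.le).mp hcs
        rw [lt_div_iff₀ hBpos] at h1
        rw [inv_pow, ← div_eq_mul_inv, lt_div_iff₀ (by positivity)]
        linarith
      have htan : ∀ i : Fin N, (c⁻¹) ^ 2 - 2 * (c⁻¹) ^ 3 * (μ' * (lam i - lamBar)) ≤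
          ((1 + μ' * lam i)⁻¹) ^ 2 := by
        intro i
        have hx : 0 < 1 + μ' * lam i := by
          have := mul_nonneg hμ.le (hlam i); linarith
        have e : μ' * (lam i - lamBar) = (1 + μ' * lam i) - c := by rw [hc]; ring
        rw [e]
        generalize 1 + μ' * lam i = x at hx
        have : (x⁻¹) ^ 2 - ((c⁻¹) ^ 2 - 2 * (c⁻¹) ^ 3 * (x - c)) =
            (x - c) ^ 2 * (2 * x + c) / (x ^ 2 * c ^ 3) := by
          field_simp; ring
        have h2 : 0 ≤ (x - c) ^ 2 * (2 * x + c) / (x ^ 2 * c ^ 3) := by positivity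
        linarith
      have hsum := Finset.sum_le_sum fun i (_ : i ∈ Finset.univ) => htan i
      rw [Finset.sum_sub_distrib, ← Finset.mul_sum, ← Finset.mul_sum, Finset.sum_sub_distrib] at hsum
      have hz0 : ∑ i, lam i - ∑ i : Fin N, lamBar = 0 := by
        rw [← htr]; simp only [Finset.sum_const, Finset.card_univ, Fintype.card_fin, nsmul_eq_mul, lamBar]
        field_simp; ring
      rw [hz0] at hsum
      simp only [Finset.sum_const, Finset.card_univ, Fintype.card_fin, nsmul_eq_mul] at hsum
      linarith
    refine ⟨div_pos (mul_pos (div_pos hk0 hN0) hnum) hden, ?_⟩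
    intro SNR hSNR hSNRτ S hScard
    have hSne : S.Nonempty := Finset.card_pos.mp (by omega)
    have hcol : ∀ (T : Finset (Fin N)), xi1 μ' T =
        ∑ j : Fin k, ∑ i, ((if i = Fin.castLE hkN j then 1 else 0) -
          Me L u T μ' i (Fin.castLE hkN j)) ^ 2 := by
      intro T
      simp only [xi1]
      rw [frobSq_eq u hortho]
      refine Finset.sum_congr rfl fun j _ => Finset.sum_congr rfl fun i _ => ?_
      have : (UK - (P T + μ' • L)⁻¹ * P T * UK).col j = u (Fin.castLE hkN j) -
          ((Pm T + μ' • L)⁻¹ * Pm T) *ᵥ u (Fin.castLE hkN j) := rfl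
      rw [this, dotProduct_sub, hortho]
      rfl
    have hxi2 : ∀ (T : Finset (Fin N)), xi2 μ' T = ∑ j, ∑ i, Me L u T μ' i j ^ 2 := by
      intro T
      simp only [xi2]
      rw [frobSq_mul_U u hortho]
      rfl
    have hAu := A_unit L hL lam u hortho heig hlam z hpos hconst Finset.univ
      ⟨z, Finset.mem_univ _⟩ μ' hμ
    have hAS := A_unit L hL lam u hortho heig hlam z hpos hconst S hSne μ' hμ
    have hx1u : xi1 μ' Finset.univ =
        ∑ j : Fin k, (1 - (1 + μ' * lam (Fin.castLE hkN j))⁻¹) ^ 2 := by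
      rw [hcol]
      refine Finset.sum_congr rfl fun j _ => ?_
      rw [Finset.sum_eq_single (Fin.castLE hkN j)]
      · rw [Me_univ L lam u hortho heig hlam μ' hμ hAu]; simp
      · intro i _ hi
        rw [Me_univ L lam u hortho heig hlam μ' hμ hAu]; simp [hi]
      · simp
    have hx2u : xi2 μ' Finset.univ = ∑ i : Fin N, ((1 + μ' * lam i)⁻¹) ^ 2 := by
      rw [hxi2]
      refine Finset.sum_congr rfl fun j _ => ?_
      rw [Finset.sum_eq_single j]
      · rw [Me_univ L lam u hortho heig hlam μ' hμ hAu]; simp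
      · intro i _ hi
        rw [Me_univ L lam u hortho heig hlam μ' hμ hAu]; simp [hi]
      · simp
    have hx2S : xi2 μ' S ≤ Bfull lam mopt := by
      rw [hxi2, ← hScard]
      exact Me_sum_bound hN le_rfl L hL lam hmono hlam0 u hortho heig hconst S hSne μ' hμ
    have hx1S : xi1 μ' S ≤ k + Bbl lam k mopt := by
      have hb := Me_sum_bound hk2 hkN L hL lam hmono hlam0 u hortho heig hconst S hSne μ' hμ
      rw [hScard] at hb
      refine le_trans ?_ (add_le_add_right hb (k : ℝ))
      have hkk : (k : ℝ) = ∑ j : Fin k, (1 : ℝ) := by simp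
      rw [hcol, hkk, ← Finset.sum_add_distrib]
      refine Finset.sum_le_sum fun j _ => ?_
      have hd := Me_diag_nonneg L hL lam u hortho heig hlam S μ' hμ hAS (Fin.castLE hkN j)
      have e : ∀ i, ((if i = Fin.castLE hkN j then 1 else 0) -
          Me L u S μ' i (Fin.castLE hkN j)) ^ 2 =
          (if i = Fin.castLE hkN j then (1 - 2 * Me L u S μ' i (Fin.castLE hkN j)) else 0) +
          Me L u S μ' i (Fin.castLE hkN j) ^ 2 := by
        intro i
        split_ifs <;> ring
      rw [Finset.sum_congr rfl fun i _ => e i, Finset.sum_add_distrib, Finset.sum_ite_eq']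
      simp only [Finset.mem_univ, if_true]
      linarith
    have hτ := (lt_div_iff₀ hden).mp hSNRτ
    have hfin : (k : ℝ) + Bbl lam k mopt -
          ∑ j : Fin k, (1 - (1 + μ' * lam (Fin.castLE hkN j))⁻¹) ^ 2 <
        ((k : ℝ) / ((N : ℝ) * SNR)) * ((∑ i : Fin N, ((1 + μ' * lam i)⁻¹) ^ 2) - Bfull lam mopt) := by
      have e : ((k : ℝ) / ((N : ℝ) * SNR)) * ((∑ i : Fin N, ((1 + μ' * lam i)⁻¹) ^ 2) - Bfull lam mopt)
        = (k : ℝ) / (N : ℝ) * ((∑ i : Fin N, ((1 + μ' * lam i)⁻¹) ^ 2) - Bfull lam mopt) / SNR := by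
        field_simp
      rw [e, lt_div_iff₀ hSNR]
      linarith
    have hcpos : 0 < (k : ℝ) / ((N : ℝ) * SNR) := by positivity
    have h2 := mul_le_mul_of_nonneg_left hx2S hcpos.le
    rw [hx1u, hx2u]
    linarith
end

section
/- Assume 1 ≤ k ≤ N and 2r√N < N. Let λ̄ := trace(L)/N, μ_ub_weak := (N^{1/4}·(2r)^{−1/2} − 1)/λ̄, and for μ' > 0 define τ_GLR_weak(μ') := (√N·(1 + μ'λ̄)⁻² − 2r) / (√N + 2r·(N/k)). Then μ_ub_weak > 0, and for every μ' with 0 < μ' < μ_ub_weak and every SNR with 0 < SNR < τ_GLR_weak(μ'), every finite S ⊆ Fin N with |S| = ⌈√N⌉ satisfies, with the GLR quantities computed with parameter μ', ξ₁(S) + (k/(N·SNR))·ξ₂(S) < ξ₁(Fin N) + (k/(N·SNR))·ξ₂(Fin N); that is, any sample set of size ⌈√N⌉ is better than full observation. -/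
open Matrix

namespace GLRaux

variable {N : ℕ}

theorem parseval (u : Fin N → Fin N → ℝ)
    (hortho : ∀ i j, u i ⬝ᵥ u j = if i = j then (1 : ℝ) else 0) (a b : Fin N → ℝ) :
    a ⬝ᵥ b = ∑ i, (u i ⬝ᵥ a) * (u i ⬝ᵥ b) := by
  have h1 : (Matrix.of u) * (Matrix.of u)ᵀ = 1 := by
    ext i j
    rw [Matrix.mul_apply, Matrix.one_apply, ← hortho i j]
    rfl
  have h2 : (Matrix.of u)ᵀ * (Matrix.of u) = 1 := mul_eq_one_comm.mp h1
  have h3 : ((Matrix.of u) *ᵥ a) ⬝ᵥ ((Matrix.of u) *ᵥ b) = a ⬝ᵥ b := by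
    rw [Matrix.dotProduct_mulVec, Matrix.vecMul_mulVec, h2]
    simp
  rw [← h3]
  rfl

theorem frob_cols {m n : Type*} [Fintype m] [Fintype n] (A : Matrix m n ℝ) :
    frobSq A = ∑ j, (fun i => A i j) ⬝ᵥ (fun i => A i j) := by
  unfold frobSq Matrix.trace
  refine Finset.sum_congr rfl fun j _ => ?_
  rfl

theorem frob_basis (u : Fin N → Fin N → ℝ)
    (hortho : ∀ i j, u i ⬝ᵥ u j = if i = j then (1 : ℝ) else 0)
    (A : Matrix (Fin N) (Fin N) ℝ) :
    frobSq A = ∑ j, (A *ᵥ u j) ⬝ᵥ (A *ᵥ u j) := by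
  have hL : frobSq A = ∑ i, (A i) ⬝ᵥ (A i) := by
    rw [frob_cols]
    simp only [dotProduct]
    rw [Finset.sum_comm]
  rw [hL]
  simp_rw [parseval u hortho (A _) (A _)]
  rw [Finset.sum_comm]
  refine Finset.sum_congr rfl fun j _ => ?_
  simp only [dotProduct_comm (u j)]
  rfl

theorem frob_nonneg {m n : Type*} [Fintype m] [Fintype n] (A : Matrix m n ℝ) : 0 ≤ frobSq A := by
  rw [frob_cols]
  exact Finset.sum_nonneg fun j _ => Finset.sum_nonneg fun i _ => mul_self_nonneg _

theorem dot_self_nonneg (a : Fin N → ℝ) : 0 ≤ a ⬝ᵥ a :=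
  Finset.sum_nonneg fun _ _ => mul_self_nonneg _

theorem cauchy (a b : Fin N → ℝ) : (a ⬝ᵥ b) ^ 2 ≤ (a ⬝ᵥ a) * (b ⬝ᵥ b) := by
  have := Finset.sum_mul_sq_le_sq_mul_sq Finset.univ a b
  simpa [dotProduct, pow_two] using this

/-- Gram determinant inequality for `p ⊥ w`. -/
theorem gram (p w y : Fin N → ℝ) (hpw : p ⬝ᵥ w = 0) (hw : 0 < w ⬝ᵥ w) :
    (w ⬝ᵥ w) * (p ⬝ᵥ y) ^ 2 ≤ (p ⬝ᵥ p) * ((w ⬝ᵥ w) * (y ⬝ᵥ y) - (w ⬝ᵥ y) ^ 2) := by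
  have h := cauchy p ((w ⬝ᵥ w) • y - (w ⬝ᵥ y) • w)
  have e1 : p ⬝ᵥ ((w ⬝ᵥ w) • y - (w ⬝ᵥ y) • w) = (w ⬝ᵥ w) * (p ⬝ᵥ y) := by
    simp [dotProduct_sub, dotProduct_smul, hpw]
  have e2 : ((w ⬝ᵥ w) • y - (w ⬝ᵥ y) • w) ⬝ᵥ ((w ⬝ᵥ w) • y - (w ⬝ᵥ y) • w)
      = (w ⬝ᵥ w) * ((w ⬝ᵥ w) * (y ⬝ᵥ y) - (w ⬝ᵥ y) ^ 2) := by
    simp only [dotProduct_sub, sub_dotProduct, dotProduct_smul, smul_dotProduct, smul_eq_mul,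
      dotProduct_comm y w]
    ring
  rw [e1, e2] at h
  nlinarith [h, hw]

theorem omega_eq {a b : ℝ} (ha : 0 < a) (hb : 0 < b) :
    4 * a * b * omegaFn (b / a) = (a + b) ^ 2 := by
  unfold omegaFn
  have hx : 0 < b / a := by positivity
  have hs : 0 < Real.sqrt (b / a) := Real.sqrt_pos.mpr hx
  have hsq : Real.sqrt (b / a) ^ 2 = b / a := Real.sq_sqrt hx.le
  have : (Real.sqrt (b / a) + 1 / Real.sqrt (b / a)) ^ 2 = b / a + 2 + a / b := by
    have : (Real.sqrt (b / a) + 1 / Real.sqrt (b / a)) ^ 2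
      = Real.sqrt (b / a) ^ 2 + 2 + 1 / Real.sqrt (b / a) ^ 2 := by
      field_simp
      ring
    rw [this, hsq]
    field_simp
  rw [this]
  field_simp
  ring

theorem one_le_omega {a b : ℝ} (ha : 0 < a) (hb : 0 < b) : 1 ≤ omegaFn (b / a) := by
  have h := omega_eq ha hb
  have hp : 0 < 4 * a * b := by positivity
  by_contra hc
  push Not at hc
  nlinarith [sq_nonneg (a - b)]

/-- Kantorovich-type bounds from the quadratic inequality. -/
theorem kant (a b : ℝ) (ha : 0 < a) (hb : 0 < b) (w y x : Fin N → ℝ)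
    (hq : w ⬝ᵥ w + a * b * (y ⬝ᵥ y) ≤ (a + b) * (w ⬝ᵥ y))
    (hx : w ⬝ᵥ y ≤ w ⬝ᵥ x) :
    y ⬝ᵥ y ≤ omegaFn (b / a) * (x ⬝ᵥ x) ∧
    ∀ p : Fin N → ℝ, p ⬝ᵥ w = 0 →
      (p ⬝ᵥ y) ^ 2 ≤ (p ⬝ᵥ p) * (omegaFn (b / a) - 1) * (x ⬝ᵥ x) := by
  have hr1 := one_le_omega ha hb
  have hr := omega_eq ha hb
  set r := omegaFn (b / a)
  have hy0 := dot_self_nonneg y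
  have hx0 := dot_self_nonneg x
  have hw0 := dot_self_nonneg w
  have hab : 0 < a * b := by positivity
  rcases hw0.eq_or_lt with hw | hw
  · have hwz : w = 0 := dotProduct_self_eq_zero.mp hw.symm
    subst hwz
    simp only [zero_dotProduct, mul_zero, zero_add] at hq
    have hyy : y ⬝ᵥ y = 0 := by nlinarith
    have hyz : y = 0 := dotProduct_self_eq_zero.mp hyy
    subst hyz
    refine ⟨?_, fun p _ => ?_⟩
    · simp only [zero_dotProduct]; positivity
    · simp only [dotProduct_zero]
      have := dot_self_nonneg p
      have h1 : 0 ≤ r - 1 := by linarith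
      rw [zero_pow two_ne_zero]
      positivity
  · have hwy : 0 ≤ w ⬝ᵥ y := by
      have : 0 ≤ (a + b) * (w ⬝ᵥ y) := by nlinarith
      exact nonneg_of_mul_nonneg_right this (by linarith)
    have hK : (w ⬝ᵥ w) * (y ⬝ᵥ y) ≤ r * (w ⬝ᵥ y) ^ 2 := by
      have h1 : (w ⬝ᵥ w + a * b * (y ⬝ᵥ y)) ^ 2 ≤ ((a + b) * (w ⬝ᵥ y)) ^ 2 :=
        pow_le_pow_left₀ (by positivity) hq 2
      have h2 : 4 * (a * b) * ((w ⬝ᵥ w) * (y ⬝ᵥ y)) ≤ 4 * (a * b) * (r * (w ⬝ᵥ y) ^ 2) := by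
        have : 4 * (a * b) * (r * (w ⬝ᵥ y) ^ 2) = ((a + b) * (w ⬝ᵥ y)) ^ 2 := by
          rw [mul_pow, ← hr]; ring
        rw [this]
        nlinarith [sq_nonneg (w ⬝ᵥ w - a * b * (y ⬝ᵥ y))]
      exact le_of_mul_le_mul_left h2 (by positivity)
    have hc : (w ⬝ᵥ y) ^ 2 ≤ (w ⬝ᵥ w) * (x ⬝ᵥ x) :=
      (pow_le_pow_left₀ hwy hx 2).trans (cauchy w x)
    refine ⟨?_, fun p hp => ?_⟩
    · refine le_of_mul_le_mul_left ?_ hw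
      calc _ ≤ _ := hK
        _ ≤ r * ((w ⬝ᵥ w) * (x ⬝ᵥ x)) := by gcongr
        _ = _ := by ring
    · refine le_of_mul_le_mul_left ?_ hw
      have hp0 := dot_self_nonneg p
      have h1 : 0 ≤ r - 1 := by linarith
      calc _ ≤ _ := gram p w y hp hw
        _ ≤ (p ⬝ᵥ p) * ((r - 1) * (w ⬝ᵥ y) ^ 2) := by
          gcongr; linarith
        _ ≤ (p ⬝ᵥ p) * ((r - 1) * ((w ⬝ᵥ w) * (x ⬝ᵥ x))) := by gcongr
        _ = _ := by ring

/-- Abstract data for the Laplacian. -/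
structure Spec (L : Matrix (Fin N) (Fin N) ℝ) (a b : ℝ) : Prop where
  ha : 0 < a
  hb : 0 < b
  quad : ∀ y : Fin N → ℝ, y ⬝ᵥ 1 = 0 →
    (L *ᵥ y) ⬝ᵥ (L *ᵥ y) + a * b * (y ⬝ᵥ y) ≤ (a + b) * ((L *ᵥ y) ⬝ᵥ y)
  ker : L *ᵥ 1 = 0
  ran : ∀ y, 1 ⬝ᵥ (L *ᵥ y) = 0

/-- indicator projection -/
noncomputable def pr (S : Finset (Fin N)) (x : Fin N → ℝ) : Fin N → ℝ :=
  fun i => if i ∈ S then x i else 0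

/-- centered indicator-restricted vector -/
noncomputable def ct (S : Finset (Fin N)) (x : Fin N → ℝ) : Fin N → ℝ :=
  fun i => if i ∈ S then x i - (∑ j ∈ S, x j) / S.card else 0

theorem ct_norm (S : Finset (Fin N)) (hS : S.Nonempty) (x : Fin N → ℝ) :
    ct S x ⬝ᵥ ct S x = (∑ j ∈ S, x j ^ 2) - (∑ j ∈ S, x j) ^ 2 / S.card := by
  have hm : (S.card : ℝ) ≠ 0 := by exact_mod_cast hS.card_pos.ne'
  have : ct S x ⬝ᵥ ct S x = ∑ j ∈ S, (x j - (∑ j ∈ S, x j) / S.card) ^ 2 := by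
    simp [dotProduct, ct, ← pow_two, Finset.sum_ite_mem]
  rw [this]
  simp only [sub_sq, Finset.sum_add_distrib, Finset.sum_sub_distrib, ← Finset.sum_mul,
    ← Finset.mul_sum, Finset.sum_const, nsmul_eq_mul]
  field_simp
  ring

/-- main pointwise estimate -/
theorem main_est (hN : 0 < N) {L : Matrix (Fin N) (Fin N) ℝ} {a b : ℝ} (hL : Spec L a b)
    (S : Finset (Fin N)) (hS : S.Nonempty) (μ : ℝ) (hμ : 0 < μ) (x v : Fin N → ℝ)
    (hv : ∀ i, μ * (L *ᵥ v) i = if i ∈ S then x i - v i else 0) :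
    (v ⬝ᵥ v - (v ⬝ᵥ 1) ^ 2 / N ≤ omegaFn (b / a) * (ct S x ⬝ᵥ ct S x)) ∧
    ((S.card : ℝ) * ((v ⬝ᵥ 1) / N) - ∑ j ∈ S, x j) ^ 2 ≤
      (S.card * (1 - S.card / N)) * (omegaFn (b / a) - 1) * (ct S x ⬝ᵥ ct S x) := by
  have hNR : (N : ℝ) ≠ 0 := by exact_mod_cast hN.ne'
  have hm : (S.card : ℝ) ≠ 0 := by exact_mod_cast hS.card_pos.ne'
  have hone : (1 : Fin N → ℝ) ⬝ᵥ 1 = N := by simp [dotProduct]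
  set c := (v ⬝ᵥ 1) / N with hc
  set y : Fin N → ℝ := v - c • 1 with hy
  set w := L *ᵥ v with hw
  have hvy : L *ᵥ y = w := by
    rw [hy, Matrix.mulVec_sub, Matrix.mulVec_smul, hL.ker]; simp [hw]
  have hy1 : y ⬝ᵥ 1 = 0 := by
    rw [hy, sub_dotProduct, smul_dotProduct, hone, hc, smul_eq_mul]
    field_simp; ring
  have hw1 : w ⬝ᵥ 1 = 0 := by rw [dotProduct_comm]; exact hL.ran v
  have hwi : ∀ i, i ∉ S → w i = 0 := by
    intro i hi
    have := hv i
    rw [if_neg hi] at this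
    exact (mul_eq_zero.mp this).resolve_left hμ.ne'
  have hq := hL.quad y hy1
  rw [hvy] at hq
  have hwv : w ⬝ᵥ y = w ⬝ᵥ v := by
    rw [hy, dotProduct_sub, dotProduct_smul, hw1]; simp
  have hwx : w ⬝ᵥ v = w ⬝ᵥ x - μ * (w ⬝ᵥ w) := by
    simp only [dotProduct, Finset.mul_sum, ← Finset.sum_sub_distrib]
    refine Finset.sum_congr rfl fun i _ => ?_
    by_cases hi : i ∈ S
    · have := hv i
      rw [if_pos hi] at this
      have h2 : v i = x i - μ * w i := by linarith
      rw [h2]; ring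
    · rw [hwi i hi]; ring
  have hwct : w ⬝ᵥ ct S x = w ⬝ᵥ x := by
    have h1 : w ⬝ᵥ ct S x = w ⬝ᵥ (x - ((∑ j ∈ S, x j) / S.card) • 1) := by
      refine Finset.sum_congr rfl fun i _ => ?_
      by_cases hi : i ∈ S
      · simp [ct, hi]
      · rw [hwi i hi]; simp
    rw [h1, dotProduct_sub, dotProduct_smul, hw1]; simp
  have hw0 := dot_self_nonneg w
  obtain ⟨k1, k2⟩ := kant a b hL.ha hL.hb w y (ct S x) hq (by rw [hwv, hwx, hwct]; nlinarith)
  refine ⟨?_, ?_⟩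
  · refine le_trans (le_of_eq ?_) k1
    rw [hy]
    simp only [dotProduct_sub, sub_dotProduct, dotProduct_smul, smul_dotProduct, smul_eq_mul, hone,
      dotProduct_comm 1 v]
    rw [hc]
    field_simp; ring
  · set q : Fin N → ℝ := pr S 1 with hqd
    have hqw : q ⬝ᵥ w = 0 := by
      rw [← hw1, dotProduct_comm]
      refine Finset.sum_congr rfl fun i _ => ?_
      by_cases hi : i ∈ S
      · simp [hqd, pr, hi]
      · rw [hwi i hi]; simp
    have hq1 : q ⬝ᵥ 1 = S.card := by simp [hqd, pr, dotProduct]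
    have hqq : q ⬝ᵥ q = S.card := by simp [hqd, pr, dotProduct]
    have hqv : q ⬝ᵥ v = ∑ j ∈ S, x j := by
      have e1 : ∀ z, q ⬝ᵥ z = ∑ j ∈ S, z j := by
        intro z; simp [hqd, pr, dotProduct, Finset.sum_ite_mem]
      have e2 : ∑ j ∈ S, (x j - v j) = 0 := by
        have : ∑ j ∈ S, (x j - v j) = ∑ j ∈ S, μ * w j := by
          refine Finset.sum_congr rfl fun i hi => ?_
          rw [hv i, if_pos hi]
        rw [this, ← Finset.mul_sum, ← e1, hqw, mul_zero]
      rw [e1]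
      rw [Finset.sum_sub_distrib] at e2
      linarith
    have := k2 (q - ((S.card : ℝ) / N) • 1) (by
      rw [sub_dotProduct, smul_dotProduct, hqw, dotProduct_comm 1 w, hw1]; simp)
    have e3 : (q - ((S.card : ℝ) / N) • 1) ⬝ᵥ y = ∑ j ∈ S, x j - S.card * c := by
      rw [sub_dotProduct, smul_dotProduct, dotProduct_comm 1 y, hy1, hy, dotProduct_sub,
        dotProduct_smul, hqv, hq1]
      simp; ring
    have e4 : (q - ((S.card : ℝ) / N) • (1 : Fin N → ℝ)) ⬝ᵥ
        (q - ((S.card : ℝ) / N) • (1 : Fin N → ℝ))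
        = S.card * (1 - S.card / N) := by
      simp only [dotProduct_sub, sub_dotProduct, dotProduct_smul, smul_dotProduct, smul_eq_mul,
        hone, dotProduct_comm 1 q, hq1, hqq]
      field_simp; ring
    rw [e3, e4] at this
    linarith [sq_abs (1:ℝ), sub_sq_comm (∑ j ∈ S, x j) (S.card * c)]

/-- The matrix `P_S + μ L`. -/
noncomputable def AM (L : Matrix (Fin N) (Fin N) ℝ) (S : Finset (Fin N)) (μ : ℝ) :
    Matrix (Fin N) (Fin N) ℝ :=
  (Matrix.diagonal fun j => if j ∈ S then (1 : ℝ) else 0) + μ • L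

theorem AM_mulVec (L : Matrix (Fin N) (Fin N) ℝ) (S : Finset (Fin N)) (μ : ℝ) (v : Fin N → ℝ)
    (i : Fin N) : (AM L S μ *ᵥ v) i = (if i ∈ S then v i else 0) + μ * (L *ᵥ v) i := by
  unfold AM
  rw [Matrix.add_mulVec, Matrix.smul_mulVec, Pi.add_apply, Matrix.mulVec_diagonal]
  simp

theorem AM_unit (hN : 0 < N) {L : Matrix (Fin N) (Fin N) ℝ} {a b : ℝ} (hL : Spec L a b)
    (S : Finset (Fin N)) (hS : S.Nonempty) (μ : ℝ) (hμ : 0 < μ) : IsUnit (AM L S μ) := by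
  have hNR : (N : ℝ) ≠ 0 := by exact_mod_cast hN.ne'
  have hm : (S.card : ℝ) ≠ 0 := by exact_mod_cast hS.card_pos.ne'
  rw [← Matrix.mulVec_injective_iff_isUnit]
  rw [← Matrix.coe_mulVecLin, injective_iff_map_eq_zero]
  intro v hv
  rw [Matrix.mulVecLin_apply] at hv
  have h := main_est hN hL S hS μ hμ 0 v (by
    intro i
    have h1 := congrFun hv i
    rw [AM_mulVec] at h1
    simp only [Pi.zero_apply] at h1 ⊢
    split_ifs at h1 ⊢ <;> linarith)
  have h0 : ct S (0 : Fin N → ℝ) = 0 := by ext i; simp [ct]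
  rw [h0] at h
  simp only [zero_dotProduct, mul_zero, Pi.zero_apply, Finset.sum_const_zero, sub_zero] at h
  have h2 : (S.card : ℝ) * ((v ⬝ᵥ 1) / N) = 0 := by
    have := sq_nonneg ((S.card : ℝ) * ((v ⬝ᵥ 1) / N))
    exact pow_eq_zero_iff two_ne_zero |>.mp (le_antisymm h.2 this)
  have h3 : v ⬝ᵥ 1 = 0 := by
    rcases mul_eq_zero.mp h2 with h | h
    · exact absurd h hm
    · rcases div_eq_zero_iff.mp h with h | h
      · exact h
      · exact absurd h hNR
  rw [h3] at h
  have h4 : v ⬝ᵥ v = 0 := le_antisymm (by simpa using h.1) (dot_self_nonneg v)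
  exact dotProduct_self_eq_zero.mp h4

theorem ar1 (m g : ℝ) (hm : 0 < m) : m * g - 1 = m * (g - 1 / m) := by
  field_simp

theorem ar2 (m n r E : ℝ) (hm : 0 < m) (hn : 0 < n) :
    m * (1 - m / n) * (r - 1) * E = m ^ 2 * E * ((1 / m - 1 / n) * (r - 1)) := by
  field_simp

theorem ar3 (m n r g : ℝ) (hm : 0 < m) :
    n * g + m * (r * (1 - 1 / m)) = n * (g - 1 / m + 1 / m) + r * (m - 1) := by
  field_simp
  ring

theorem ar4 (m n r : ℝ) (hm : 0 < m) (hn : 0 < n) :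
    n * ((1 / m - 1 / n) * (r - 1) + 1 / m) + r * (m - 1)
      = r * (n / m + m - 1) - (r - 1) := by
  field_simp
  ring

/-- Bound on the noise sensitivity. -/
theorem xi2_bound (hN : 0 < N) {L : Matrix (Fin N) (Fin N) ℝ} {a b : ℝ} (hL : Spec L a b)
    (S : Finset (Fin N)) (hS : S.Nonempty) (μ : ℝ) (hμ : 0 < μ) :
    frobSq ((AM L S μ)⁻¹ * (Matrix.diagonal fun j => if j ∈ S then (1 : ℝ) else 0)) ≤
      omegaFn (b / a) * (N / S.card + S.card - 1) := by
  have hNR : (0 : ℝ) < N := by exact_mod_cast hN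
  have hm : (0 : ℝ) < S.card := by exact_mod_cast hS.card_pos
  have hmN : (S.card : ℝ) ≤ N := by
    have := Finset.card_le_univ S
    rw [Fintype.card_fin] at this
    exact_mod_cast this
  have hr1 := one_le_omega hL.ha hL.hb
  have hU := AM_unit hN hL S hS μ hμ
  have hdet := (Matrix.isUnit_iff_isUnit_det _).mp hU
  set A := AM L S μ with hA
  set H := A⁻¹ * (Matrix.diagonal fun j => if j ∈ S then (1 : ℝ) else 0) with hH
  have hHv : ∀ x : Fin N → ℝ, ∀ i,
      μ * (L *ᵥ (H *ᵥ x)) i = if i ∈ S then x i - (H *ᵥ x) i else 0 := by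
    intro x i
    have h1 : A *ᵥ (H *ᵥ x) = (Matrix.diagonal fun j => if j ∈ S then (1 : ℝ) else 0) *ᵥ x := by
      rw [Matrix.mulVec_mulVec, hH, ← Matrix.mul_assoc, Matrix.mul_nonsing_inv _ hdet,
        Matrix.one_mul]
    have h2 := congrFun h1 i
    rw [hA, AM_mulVec, Matrix.mulVec_diagonal] at h2
    split_ifs at h2 ⊢ <;> linarith
  have key := fun x => main_est hN hL S hS μ hμ x (H *ᵥ x) (hHv x)
  set r := omegaFn (b / a)
  set g : Fin N → ℝ := fun j => ((H *ᵥ Pi.single j 1) ⬝ᵥ 1) / N with hg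
  have hgx : ∀ x, ((H *ᵥ x) ⬝ᵥ 1) / N = g ⬝ᵥ x := by
    intro x
    have h1 : ∀ j, g j = (1 ᵥ* H) j / N := by
      intro j
      rw [hg]
      simp only
      rw [dotProduct_comm, Matrix.dotProduct_mulVec]
      simp
    have h2 : g = (1 / (N:ℝ)) • (1 ᵥ* H) := by
      ext j; rw [h1]; simp; ring
    rw [dotProduct_comm, Matrix.dotProduct_mulVec, h2, smul_dotProduct, smul_eq_mul]
    ring
  have hgS : ∀ j, j ∉ S → g j = 0 := by
    intro j hj
    have : H *ᵥ Pi.single j 1 = 0 := by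
      rw [hH, ← Matrix.mulVec_mulVec]
      have : (Matrix.diagonal fun j => if j ∈ S then (1 : ℝ) else 0) *ᵥ Pi.single j 1 = 0 := by
        ext i
        rw [Matrix.mulVec_diagonal]
        by_cases hi : i = j
        · subst hi; simp [hj]
        · simp [Pi.single_apply, hi]
      rw [this]; simp
    simp only [hg]
    rw [this, zero_dotProduct, zero_div]
  have hgsum : ∑ j ∈ S, g j = 1 := by
    have h1 := (key (pr S 1)).2
    have hc : ct S (pr S 1) = 0 := by
      ext i
      have : ∑ j ∈ S, pr S (1 : Fin N → ℝ) j = S.card := by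
        rw [Finset.sum_congr rfl (g := fun _ => (1:ℝ)) (fun i hi => by simp [pr, hi])]
        simp
      by_cases hi : i ∈ S
      · simp only [ct, this, hi, if_true]
        rw [div_self hm.ne']; simp [pr, hi]
      · simp [ct, hi]
    have hs : ∑ j ∈ S, pr S (1 : Fin N → ℝ) j = S.card := by
      rw [Finset.sum_congr rfl (g := fun _ => (1:ℝ)) (fun i hi => by simp [pr, hi])]
      simp
    rw [hc, hgx, hs] at h1
    simp only [zero_dotProduct, mul_zero] at h1
    have h2 : (S.card : ℝ) * (g ⬝ᵥ pr S 1) - S.card = 0 :=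
      pow_eq_zero_iff two_ne_zero |>.mp (le_antisymm h1 (sq_nonneg _))
    have h3 : g ⬝ᵥ pr S 1 = ∑ j ∈ S, g j := by
      simp [dotProduct, pr, Finset.sum_ite_mem]
    rw [h3] at h2
    have h4 : (S.card : ℝ) * (∑ j ∈ S, g j) = S.card * 1 := by linarith
    exact mul_left_cancel₀ hm.ne' h4
  have hg2 : ∑ j ∈ S, g j ^ 2 = g ⬝ᵥ g := by
    rw [dotProduct]
    rw [← Finset.sum_subset (Finset.subset_univ S) (fun i _ hi => by rw [hgS i hi]; simp)]
    simp [pow_two]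
  have hgj : ∀ j, ((H *ᵥ Pi.single j 1) ⬝ᵥ 1) = N * g j := by
    intro j
    simp only [hg]
    rw [mul_div_cancel₀ _ hNR.ne']
  clear_value g
  obtain ⟨E, hE⟩ : ∃ E, E = g ⬝ᵥ g - 1 / S.card := ⟨_, rfl⟩
  have hEct : ct S g ⬝ᵥ ct S g = E := by
    rw [ct_norm S hS, hgsum, hg2, one_pow, hE]
  have hE0 : 0 ≤ E := hEct ▸ dot_self_nonneg _
  have hEb : E ≤ (1 / S.card - 1 / N) * (r - 1) := by
    have h1 := (key g).2
    rw [hgx, hgsum, hEct] at h1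
    have h2 : (S.card : ℝ) * (g ⬝ᵥ g) - 1 = S.card * E := by
      rw [hE]; exact ar1 _ _ hm
    rw [h2] at h1
    rcases hE0.eq_or_lt with h | h
    · rw [← h]
      have : (1:ℝ) / N ≤ 1 / S.card := one_div_le_one_div_of_le hm hmN
      exact mul_nonneg (by linarith) (by linarith)
    · have h3 : (S.card : ℝ) ^ 2 * E * E ≤
          (S.card : ℝ) ^ 2 * E * ((1 / S.card - 1 / N) * (r - 1)) := by
        calc _ = (S.card * E) ^ 2 := by ring
          _ ≤ _ := h1
          _ = _ := ar2 _ _ _ _ hm hNR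
      exact le_of_mul_le_mul_left h3 (mul_pos (pow_pos hm 2) h)
  have hcol : ∀ j, (fun i => H i j) = H *ᵥ Pi.single j 1 := by
    intro j; ext i; simp
  rw [frob_cols]
  simp_rw [hcol]
  have hcb : ∀ j, (H *ᵥ Pi.single j 1) ⬝ᵥ (H *ᵥ Pi.single j 1) ≤
      N * g j ^ 2 + (if j ∈ S then r * (1 - 1 / S.card) else 0) := by
    intro j
    have h1 := (key (Pi.single j 1)).1
    have h2 : ((H *ᵥ Pi.single j 1) ⬝ᵥ 1) ^ 2 / N = N * g j ^ 2 := by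
      rw [hgj]; field_simp
    rw [h2] at h1
    have h3 : ct S (Pi.single j (1:ℝ)) ⬝ᵥ ct S (Pi.single j 1)
        = if j ∈ S then 1 - 1 / (S.card : ℝ) else 0 := by
      rw [ct_norm S hS]
      have : ∀ i, (Pi.single j (1:ℝ) : Fin N → ℝ) i ^ 2 = (Pi.single j (1:ℝ) : Fin N → ℝ) i := by
        intro i
        by_cases hi : i = j <;> simp [Pi.single_apply, hi]
      simp_rw [this, Pi.single_apply]
      rw [Finset.sum_ite_eq']
      split_ifs <;> simp
    rw [h3] at h1
    split_ifs at h1 ⊢ <;> linarith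
  calc _ ≤ ∑ j, (N * g j ^ 2 + (if j ∈ S then r * (1 - 1 / S.card) else 0)) :=
        Finset.sum_le_sum fun j _ => hcb j
    _ = N * (g ⬝ᵥ g) + S.card * (r * (1 - 1 / S.card)) := by
        rw [Finset.sum_add_distrib, ← Finset.mul_sum]
        congr 1
        · simp [dotProduct, pow_two]
        · simp
    _ = N * (E + 1 / S.card) + r * (S.card - 1) := by
        rw [hE]; exact ar3 _ _ _ _ hm
    _ ≤ N * ((1 / S.card - 1 / N) * (r - 1) + 1 / S.card) + r * (S.card - 1) := by gcongr
    _ = r * (N / S.card + S.card - 1) - (r - 1) := ar4 _ _ _ hm hNR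
    _ ≤ _ := by linarith

theorem spec_of (hN : 2 ≤ N) (G : SimpleGraph (Fin N)) [DecidableRel G.Adj]
    (lam : Fin N → ℝ) (hmono : StrictMono lam) (hlam0 : lam ⟨0, by omega⟩ = 0)
    (u : Fin N → Fin N → ℝ)
    (hortho : ∀ i j, u i ⬝ᵥ u j = if i = j then (1 : ℝ) else 0)
    (heig : ∀ i, (G.lapMatrix ℝ).mulVec (u i) = lam i • u i) :
    Spec (G.lapMatrix ℝ) (lam ⟨1, by omega⟩) (lam ⟨N - 1, by omega⟩) := by
  have hsymm : ∀ x y : Fin N → ℝ, x ⬝ᵥ (G.lapMatrix ℝ *ᵥ y) = (G.lapMatrix ℝ *ᵥ x) ⬝ᵥ y := by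
    intro x y
    rw [Matrix.dotProduct_mulVec, ← Matrix.mulVec_transpose, (G.isSymm_lapMatrix (R := ℝ)).eq]
  have hker : G.lapMatrix ℝ *ᵥ (1 : Fin N → ℝ) = 0 := G.lapMatrix_mulVec_const_eq_zero
  have h1 : 0 < lam ⟨1, by omega⟩ := by
    rw [← hlam0]; exact hmono (by simp [Fin.lt_def])
  have h2 : lam ⟨1, by omega⟩ ≤ lam ⟨N - 1, by omega⟩ :=
    hmono.monotone (by simp [Fin.le_def]; omega)
  have hco : ∀ i y, u i ⬝ᵥ (G.lapMatrix ℝ *ᵥ y) = lam i * (u i ⬝ᵥ y) := by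
    intro i y; rw [hsymm, heig, smul_dotProduct, smul_eq_mul]
  refine ⟨h1, h1.trans_le h2, ?_, hker, fun y => by rw [hsymm, hker]; simp⟩
  intro y hy
  have hpos : ∀ i : Fin N, i ≠ ⟨0, by omega⟩ → lam ⟨1, by omega⟩ ≤ lam i := by
    intro i hi
    apply hmono.monotone
    have : (i : ℕ) ≠ 0 := fun h => hi (Fin.ext h)
    simp [Fin.le_def]; omega
  have hle : ∀ i : Fin N, lam i ≤ lam ⟨N - 1, by omega⟩ := by
    intro i
    apply hmono.monotone
    simp [Fin.le_def]; omega
  have hz : ∀ i : Fin N, i ≠ ⟨0, by omega⟩ → u i ⬝ᵥ 1 = 0 := by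
    intro i hi
    have := hco i 1
    rw [hker, dotProduct_zero] at this
    exact (mul_eq_zero.mp this.symm).resolve_left (h1.trans_le (hpos i hi)).ne'
  have hsum : ∀ z : Fin N → ℝ, z ⬝ᵥ 1 = (u ⟨0, by omega⟩ ⬝ᵥ z) * (u ⟨0, by omega⟩ ⬝ᵥ 1) := by
    intro z
    rw [parseval u hortho z 1]
    refine Finset.sum_eq_single _ (fun i _ hi => by rw [hz i hi, mul_zero]) (by simp)
  have hne : u ⟨0, by omega⟩ ⬝ᵥ 1 ≠ 0 := by
    intro h
    have := hsum 1
    rw [h] at this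
    simp [dotProduct] at this
    omega
  have hy0 : u ⟨0, by omega⟩ ⬝ᵥ y = 0 := by
    have := hsum y
    rw [hy] at this
    exact (mul_eq_zero.mp this.symm).resolve_right hne
  rw [parseval u hortho (_ *ᵥ y) (_ *ᵥ y), parseval u hortho y y, parseval u hortho (_ *ᵥ y) y]
  simp_rw [hco]
  rw [Finset.mul_sum, Finset.mul_sum, ← Finset.sum_add_distrib]
  refine Finset.sum_le_sum fun i _ => ?_
  by_cases hi : i = ⟨0, by omega⟩
  · rw [hi, hy0]; simp
  · have ha := hpos i hi
    have hb := hle i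
    nlinarith [mul_nonneg (mul_nonneg (sub_nonneg.mpr ha) (sub_nonneg.mpr hb))
      (sq_nonneg (u i ⬝ᵥ y))]

theorem trace_eq (L : Matrix (Fin N) (Fin N) ℝ) (lam : Fin N → ℝ) (u : Fin N → Fin N → ℝ)
    (hortho : ∀ i j, u i ⬝ᵥ u j = if i = j then (1 : ℝ) else 0)
    (heig : ∀ i, L *ᵥ (u i) = lam i • u i) : Matrix.trace L = ∑ i, lam i := by
  have h1 : (Matrix.of u) * (Matrix.of u)ᵀ = 1 := by
    ext i j
    rw [Matrix.mul_apply, Matrix.one_apply, ← hortho i j]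
    rfl
  have h2 : (Matrix.of u)ᵀ * (Matrix.of u) = 1 := mul_eq_one_comm.mp h1
  have h3 : Matrix.trace L = Matrix.trace ((Matrix.of u) * (L * (Matrix.of u)ᵀ)) := by
    rw [Matrix.trace_mul_comm, Matrix.mul_assoc, h2, Matrix.mul_one]
  rw [h3]
  refine Finset.sum_congr rfl fun i _ => ?_
  have : ((Matrix.of u) * (L * (Matrix.of u)ᵀ)) i i = u i ⬝ᵥ (L *ᵥ u i) := rfl
  rw [Matrix.diag_apply, this, heig, dotProduct_smul, hortho]
  simp

/-- Bound of the bias. -/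
theorem xi1_bound {k : ℕ} (hkN : k ≤ N) (L : Matrix (Fin N) (Fin N) ℝ) (lam : Fin N → ℝ)
    (u : Fin N → Fin N → ℝ)
    (hortho : ∀ i j, u i ⬝ᵥ u j = if i = j then (1 : ℝ) else 0)
    (heig : ∀ i, L *ᵥ (u i) = lam i • u i)
    (hsymm : ∀ x y : Fin N → ℝ, x ⬝ᵥ (L *ᵥ y) = (L *ᵥ x) ⬝ᵥ y)
    (hpos : ∀ i, 0 ≤ lam i) (S : Finset (Fin N)) (μ : ℝ) (hμ : 0 < μ)
    (hU : IsUnit (AM L S μ)) :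
    frobSq ((Matrix.of fun i j => u (Fin.castLE hkN j) i : Matrix (Fin N) (Fin k) ℝ) -
      (AM L S μ)⁻¹ * (Matrix.diagonal fun j => if j ∈ S then (1 : ℝ) else 0) *
        (Matrix.of fun i j => u (Fin.castLE hkN j) i : Matrix (Fin N) (Fin k) ℝ)) ≤
    k + frobSq ((AM L S μ)⁻¹ * (Matrix.diagonal fun j => if j ∈ S then (1 : ℝ) else 0)) := by
  have hdet := (Matrix.isUnit_iff_isUnit_det _).mp hU
  have hinv : (AM L S μ)⁻¹ * AM L S μ = 1 := Matrix.nonsing_inv_mul _ hdet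
  have hinv' : AM L S μ * (AM L S μ)⁻¹ = 1 := Matrix.mul_nonsing_inv _ hdet
  set D : Matrix (Fin N) (Fin N) ℝ := (Matrix.diagonal fun j => if j ∈ S then (1 : ℝ) else 0)
    with hD
  set H := (AM L S μ)⁻¹ * D with hH
  have hHu : ∀ j, 0 ≤ u j ⬝ᵥ (H *ᵥ u j) := by
    intro j
    set s := (AM L S μ)⁻¹ *ᵥ u j with hs
    have hAs : AM L S μ *ᵥ s = u j := by
      rw [hs, Matrix.mulVec_mulVec, hinv', Matrix.one_mulVec]
    have hHs : H *ᵥ u j = u j - (μ * lam j) • s := by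
      have hDA : D = AM L S μ - μ • L := by simp [AM, hD]
      rw [hH, ← Matrix.mulVec_mulVec, hDA, Matrix.sub_mulVec, Matrix.smul_mulVec, heig,
        Matrix.mulVec_sub, Matrix.mulVec_mulVec, hinv, Matrix.one_mulVec, Matrix.mulVec_smul,
        Matrix.mulVec_smul, ← hs, smul_smul]
    have ht : u j ⬝ᵥ s ≥ μ * (lam j * (u j ⬝ᵥ s) ^ 2) := by
      have e1 : u j ⬝ᵥ s = s ⬝ᵥ (AM L S μ *ᵥ s) := by rw [hAs, dotProduct_comm]
      have e2 : s ⬝ᵥ (AM L S μ *ᵥ s) ≥ μ * (s ⬝ᵥ (L *ᵥ s)) := by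
        simp only [dotProduct, Finset.mul_sum]
        refine Finset.sum_le_sum fun i _ => ?_
        rw [AM_mulVec]
        have : 0 ≤ s i * (if i ∈ S then s i else 0) := by
          split_ifs
          · exact mul_self_nonneg _
          · simp
        simp only [mul_add]
        linarith
      have e3 : s ⬝ᵥ (L *ᵥ s) = ∑ i, lam i * (u i ⬝ᵥ s) ^ 2 := by
        rw [parseval u hortho]
        refine Finset.sum_congr rfl fun i _ => ?_
        rw [hsymm (u i), heig, smul_dotProduct, smul_eq_mul]
        ring
      have e4 : lam j * (u j ⬝ᵥ s) ^ 2 ≤ s ⬝ᵥ (L *ᵥ s) := by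
        rw [e3]
        exact Finset.single_le_sum (f := fun i => lam i * (u i ⬝ᵥ s) ^ 2)
          (fun i _ => mul_nonneg (hpos i) (sq_nonneg _)) (Finset.mem_univ j)
      have := mul_le_mul_of_nonneg_left e4 hμ.le
      linarith
    rw [hHs, dotProduct_sub, dotProduct_smul, hortho, if_pos rfl, smul_eq_mul]
    set t := u j ⬝ᵥ s
    have hl := hpos j
    by_contra hc
    push Not at hc
    have hlt : 0 < μ * lam j * t := by linarith
    have ht0 : 0 < t := pos_of_mul_pos_right hlt (by positivity)
    nlinarith
  rw [frob_cols]
  have hcol : ∀ j : Fin k, (fun i => ((Matrix.of fun i j => u (Fin.castLE hkN j) i :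
      Matrix (Fin N) (Fin k) ℝ) - H * (Matrix.of fun i j => u (Fin.castLE hkN j) i)) i j)
      = u (Fin.castLE hkN j) - H *ᵥ u (Fin.castLE hkN j) := by
    intro j; ext i
    rfl
  simp_rw [hcol]
  rw [frob_basis u hortho H]
  have hb : ∀ j, (u j - H *ᵥ u j) ⬝ᵥ (u j - H *ᵥ u j) ≤ 1 + (H *ᵥ u j) ⬝ᵥ (H *ᵥ u j) := by
    intro j
    simp only [dotProduct_sub, sub_dotProduct, hortho, if_true, dotProduct_comm (H *ᵥ u j) (u j)]
    linarith [hHu j]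
  calc _ ≤ ∑ j : Fin k, (1 + (H *ᵥ u (Fin.castLE hkN j)) ⬝ᵥ (H *ᵥ u (Fin.castLE hkN j))) :=
        Finset.sum_le_sum fun j _ => hb _
    _ = k + ∑ j : Fin k, (H *ᵥ u (Fin.castLE hkN j)) ⬝ᵥ (H *ᵥ u (Fin.castLE hkN j)) := by
        rw [Finset.sum_add_distrib]; simp
    _ ≤ _ := by
        gcongr
        have hmap := Finset.sum_map Finset.univ (Fin.castLEEmb hkN)
          (fun j => (H *ᵥ u j) ⬝ᵥ (H *ᵥ u j))
        simp only [Fin.coe_castLEEmb] at hmap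
        rw [← hmap]
        exact Finset.sum_le_sum_of_subset_of_nonneg (Finset.subset_univ _)
          fun i _ _ => dot_self_nonneg _

/-- Lower bound for full observation. -/
theorem xi2_univ (hN : 0 < N) (L : Matrix (Fin N) (Fin N) ℝ) (lam : Fin N → ℝ)
    (u : Fin N → Fin N → ℝ)
    (hortho : ∀ i j, u i ⬝ᵥ u j = if i = j then (1 : ℝ) else 0)
    (heig : ∀ i, L *ᵥ (u i) = lam i • u i)
    (hpos : ∀ i, 0 ≤ lam i) (μ : ℝ) (hμ : 0 < μ)
    (hU : IsUnit (AM L Finset.univ μ)) :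
    N * ((1 + μ * (Matrix.trace L / N)) ^ 2)⁻¹ ≤
    frobSq ((AM L Finset.univ μ)⁻¹ *
      (Matrix.diagonal fun j => if j ∈ (Finset.univ : Finset (Fin N)) then (1 : ℝ) else 0)) := by
  have hNR : (0 : ℝ) < N := by exact_mod_cast hN
  have hdet := (Matrix.isUnit_iff_isUnit_det _).mp hU
  have hinv : (AM L Finset.univ μ)⁻¹ * AM L Finset.univ μ = 1 := Matrix.nonsing_inv_mul _ hdet
  have hD : (Matrix.diagonal fun j => if j ∈ (Finset.univ : Finset (Fin N)) then (1 : ℝ) else 0)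
    = 1 := by simp
  rw [hD, Matrix.mul_one, frob_basis u hortho]
  have hl : ∀ j, 0 < 1 + μ * lam j := fun j => by have := hpos j; positivity
  have hAu : ∀ j, (AM L Finset.univ μ)⁻¹ *ᵥ u j = (1 + μ * lam j)⁻¹ • u j := by
    intro j
    have h1 : AM L Finset.univ μ *ᵥ u j = (1 + μ * lam j) • u j := by
      ext i; rw [AM_mulVec, heig]; simp; ring
    have h2 : (1 + μ * lam j) • ((AM L Finset.univ μ)⁻¹ *ᵥ u j) = u j := by
      rw [← Matrix.mulVec_smul, ← h1, Matrix.mulVec_mulVec, hinv, Matrix.one_mulVec]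
    nth_rw 2 [← h2]
    rw [smul_smul, inv_mul_cancel₀ (hl j).ne', one_smul]
  simp_rw [hAu, smul_dotProduct, dotProduct_smul, hortho, if_true, smul_eq_mul, mul_one]
  have htr := trace_eq L lam u hortho heig
  set t := 1 + μ * (Matrix.trace L / N) with ht
  have ht0 : 0 < t := by
    have : 0 ≤ Matrix.trace L := by rw [htr]; exact Finset.sum_nonneg fun i _ => hpos i
    positivity
  have htan : ∀ a : ℝ, 0 < a → (t ^ 2)⁻¹ - 2 * (a - t) * (t ^ 3)⁻¹ ≤ a⁻¹ * a⁻¹ := by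
    intro a ha
    have : a⁻¹ * a⁻¹ - ((t ^ 2)⁻¹ - 2 * (a - t) * (t ^ 3)⁻¹)
        = (a - t) ^ 2 * (2 * a + t) / (a ^ 2 * t ^ 3) := by
      field_simp; ring
    have h2 : 0 ≤ (a - t) ^ 2 * (2 * a + t) / (a ^ 2 * t ^ 3) := by positivity
    linarith
  refine le_trans (le_of_eq ?_) (Finset.sum_le_sum fun j _ => htan _ (hl j))
  rw [Finset.sum_sub_distrib, ← Finset.sum_mul, ← Finset.mul_sum]
  have : ∑ j, (1 + μ * lam j - t) = 0 := by
    simp only [Finset.sum_sub_distrib, Finset.sum_add_distrib, ← Finset.mul_sum, ← htr,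
      Finset.sum_const, Finset.card_univ, Fintype.card_fin, nsmul_eq_mul]
    rw [ht]; field_simp; ring
  rw [this]
  simp

end GLRaux

/-- Paper's Proposition 3 (`GLR_simple`) for GLR under full-band noise: if `2r√N < N`,
then `μ_ub_weak > 0` and for every `0 < μ' < μ_ub_weak` and every
`0 < SNR < τ_GLR_weak(μ')`, any sample set of size `⌈√N⌉` is better than full observation. -/
theorem stmt_17 (N k : ℕ) (hN : 2 ≤ N) (hk : 1 ≤ k) (hkN : k ≤ N)
    (G : SimpleGraph (Fin N)) [DecidableRel G.Adj] (hG : G.Connected)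
    (lam : Fin N → ℝ) (hmono : StrictMono lam) (hlam0 : lam ⟨0, by omega⟩ = 0)
    (u : Fin N → Fin N → ℝ)
    (hortho : ∀ i j, u i ⬝ᵥ u j = if i = j then (1 : ℝ) else 0)
    (heig : ∀ i, (G.lapMatrix ℝ).mulVec (u i) = lam i • u i)
    (hr : 2 * omegaFn (eig1 lam N / eig1 lam 2) * Real.sqrt (N : ℝ) < (N : ℝ)) :
    let L := G.lapMatrix ℝ
    let UK : Matrix (Fin N) (Fin k) ℝ := Matrix.of fun i j => u (Fin.castLE hkN j) i
    let P : Finset (Fin N) → Matrix (Fin N) (Fin N) ℝ :=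
      fun T => Matrix.diagonal fun j => if j ∈ T then 1 else 0
    let xi1 : ℝ → Finset (Fin N) → ℝ :=
      fun μ' T => frobSq (UK - (P T + μ' • L)⁻¹ * P T * UK)
    let xi2 : ℝ → Finset (Fin N) → ℝ :=
      fun μ' T => frobSq ((P T + μ' • L)⁻¹ * P T)
    let r := omegaFn (eig1 lam N / eig1 lam 2)
    let lamBar := Matrix.trace L / (N : ℝ)
    let μubWeak :=
      ((N : ℝ) ^ ((1 : ℝ) / 4) * (2 * r) ^ (-(1 : ℝ) / 2) - 1) / lamBar
    let τWeak : ℝ → ℝ := fun μ' =>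
      (Real.sqrt (N : ℝ) * ((1 + μ' * lamBar) ^ 2)⁻¹ - 2 * r) /
        (Real.sqrt (N : ℝ) + 2 * r * ((N : ℝ) / (k : ℝ)))
    0 < μubWeak ∧
    ∀ μ', 0 < μ' → μ' < μubWeak →
      ∀ SNR, 0 < SNR → SNR < τWeak μ' →
        ∀ S : Finset (Fin N), S.card = ⌈Real.sqrt (N : ℝ)⌉₊ →
          xi1 μ' S + ((k : ℝ) / ((N : ℝ) * SNR)) * xi2 μ' S <
            xi1 μ' Finset.univ + ((k : ℝ) / ((N : ℝ) * SNR)) * xi2 μ' Finset.univ := by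
  intro L UK P xi1 xi2 r lamBar μubWeak τWeak
  have hN0 : 0 < N := by omega
  have hNR : (0 : ℝ) < N := by exact_mod_cast hN0
  have hkR : (0 : ℝ) < k := by exact_mod_cast hk
  have hspec := GLRaux.spec_of hN G lam hmono hlam0 u hortho heig
  have hrdef : r = omegaFn (lam ⟨N - 1, by omega⟩ / lam ⟨1, by omega⟩) := by
    have e1 : eig1 lam N = lam ⟨N - 1, by omega⟩ := by
      unfold eig1; rw [dif_pos]
    have e2 : eig1 lam 2 = lam ⟨1, by omega⟩ := by
      unfold eig1; rw [dif_pos]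
    show omegaFn _ = _
    rw [e1, e2]
  have hr1 : 1 ≤ r := by rw [hrdef]; exact GLRaux.one_le_omega hspec.ha hspec.hb
  have hr' : 2 * r * Real.sqrt N < N := hr
  have hpos : ∀ i, 0 ≤ lam i := fun i => by
    rw [← hlam0]; exact hmono.monotone (by simp [Fin.le_def])
  have htr : Matrix.trace L = ∑ i, lam i := GLRaux.trace_eq L lam u hortho heig
  have hlb : 0 < lamBar := by
    have : 0 < Matrix.trace L := by
      rw [htr]
      exact Finset.sum_pos' (fun i _ => hpos i) ⟨⟨1, by omega⟩, Finset.mem_univ _, hspec.ha⟩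
    exact div_pos this hNR
  set q := Real.sqrt (N : ℝ) with hq
  have hq0 : 0 < q := Real.sqrt_pos.mpr hNR
  have hqq : q * q = N := Real.mul_self_sqrt hNR.le
  have h2r : 2 * r < q := by
    rw [← hqq] at hr'
    exact lt_of_mul_lt_mul_right hr' hq0.le
  refine ⟨?_, ?_⟩
  · refine div_pos ?_ hlb
    have e1 : (N : ℝ) ^ ((1 : ℝ) / 4) = q ^ ((1 : ℝ) / 2) := by
      rw [hq, Real.sqrt_eq_rpow, ← Real.rpow_mul hNR.le]; norm_num
    have e2 : (2 * r) ^ ((1 : ℝ) / 2) < q ^ ((1 : ℝ) / 2) :=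
      Real.rpow_lt_rpow (by linarith) h2r (by norm_num)
    have e3 : 0 < (2 * r) ^ ((1 : ℝ) / 2) := Real.rpow_pos_of_pos (by linarith) _
    have e4 : (2 * r) ^ (-(1 : ℝ) / 2) = ((2 * r) ^ ((1 : ℝ) / 2))⁻¹ := by
      rw [← Real.rpow_neg (by linarith)]; norm_num
    rw [e1, e4, sub_pos, ← div_eq_mul_inv, one_lt_div e3]
    exact e2
  · intro μ hμ _ s hs hsτ S hcard
    have hmge : q ≤ S.card := by rw [hcard]; exact Nat.le_ceil _
    have hmlt : (S.card : ℝ) < q + 1 := by rw [hcard]; exact Nat.ceil_lt_add_one hq0.le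
    have hm0 : (0 : ℝ) < S.card := hq0.trans_le hmge
    have hS : S.Nonempty := Finset.card_pos.mp (by exact_mod_cast hm0)
    have hne : (Finset.univ : Finset (Fin N)).Nonempty := ⟨⟨0, by omega⟩, Finset.mem_univ _⟩
    have hsymm : ∀ x y : Fin N → ℝ, x ⬝ᵥ (L *ᵥ y) = (L *ᵥ x) ⬝ᵥ y := by
      intro x y
      rw [Matrix.dotProduct_mulVec, ← Matrix.mulVec_transpose, (G.isSymm_lapMatrix (R := ℝ)).eq]
    have b2 : xi2 μ S ≤ r * (N / S.card + S.card - 1) := by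
      rw [hrdef]; exact GLRaux.xi2_bound hN0 hspec S hS μ hμ
    have b2' : xi2 μ S ≤ 2 * r * q := by
      have : (N : ℝ) / S.card ≤ q := by
        rw [div_le_iff₀ hm0, ← hqq]; gcongr
      nlinarith
    have b1 : xi1 μ S ≤ k + xi2 μ S :=
      GLRaux.xi1_bound hkN L lam u hortho heig hsymm hpos S μ hμ
        (GLRaux.AM_unit hN0 hspec S hS μ hμ)
    have b3 : N * ((1 + μ * lamBar) ^ 2)⁻¹ ≤ xi2 μ Finset.univ :=
      GLRaux.xi2_univ hN0 L lam u hortho heig hpos μ hμ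
        (GLRaux.AM_unit hN0 hspec Finset.univ hne μ hμ)
    have b4 : 0 ≤ xi1 μ Finset.univ := GLRaux.frob_nonneg _
    have hτ : s < (q * ((1 + μ * lamBar) ^ 2)⁻¹ - 2 * r) / (q + 2 * r * ((N : ℝ) / (k : ℝ))) :=
      hsτ
    set c := ((1 + μ * lamBar) ^ 2)⁻¹
    have hden : 0 < q + 2 * r * ((N : ℝ) / (k : ℝ)) := by positivity
    rw [lt_div_iff₀ hden] at hτ
    set f := (k : ℝ) / ((N : ℝ) * s) with hf
    have hf0 : 0 < f := by positivity
    have hmul : f * q * (s * (q + 2 * r * ((N : ℝ) / (k : ℝ)))) < f * q * (q * c - 2 * r) :=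
      mul_lt_mul_of_pos_left hτ (by positivity)
    have e1 : f * q * (s * (q + 2 * r * ((N : ℝ) / (k : ℝ)))) = k + 2 * r * q := by
      rw [hf]
      field_simp
      rw [← hqq]; ring
    have e2 : f * q * (q * c - 2 * r) = f * (N * c) - f * (2 * r * q) := by
      rw [← hqq]; ring
    rw [e1, e2] at hmul
    have b5 := mul_le_mul_of_nonneg_left b2' hf0.le
    have b6 := mul_le_mul_of_nonneg_left b3 hf0.le
    linarith
end
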